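/- Let q be an odd prime power, d ≥ 2, let Q be a non-degenerate quadratic form on F_q^d, let E ⊆ F_q^d, let k ≥ 2 be an even integer, and let t ∈ F_q∖{0}. Set S_t = {x ∈ F_q^d : Q(x) = t}. Then |ν_k(t) − |S_t|·|E|^k/q^d| ≤ 2·q^{(d−1)/2}·Λ_k(E). -/

import Mathlib

open Finset

/-- The `k`-energy `Λ_k(E)` of a set `E` (intended for even `k = 2m`): the number of
`k`-tuples from `E` whose first `k/2` entries and last `k/2` entries have equal sums. -/
noncomputable def energy {G : Type} [AddCommMonoid G] (E : Finset G) (k : ℕ) : ℕ :=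
  Nat.card {x : Fin k → G // (∀ i, x i ∈ E) ∧
    (∑ i ∈ Finset.univ.filter (fun i : Fin k => (i : ℕ) < k / 2), x i) =
    (∑ i ∈ Finset.univ.filter (fun i : Fin k => ¬ (i : ℕ) < k / 2), x i)}

/-- `ν_k(t)`: the number of `k`-tuples from `E` whose sum lies on the level set `Q = t`. -/
noncomputable def nuQ {F : Type} [Field F] [Fintype F] {d : ℕ}
    (Q : QuadraticForm F (Fin d → F)) (E : Finset (Fin d → F)) (k : ℕ) (t : F) : ℕ :=
  Nat.card {x : Fin k → (Fin d → F) // (∀ i, x i ∈ E) ∧ Q (∑ i, x i) = t}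

open Polynomial in
theorem natDegree_lt_iff_degree_lt_of_pos {L : Type*} [Semiring L] {f : L[X]} {n : ℕ}
    (hn : 0 < n) : f.natDegree < n ↔ f.degree < n := by
  by_cases h : f = 0
  · simp [h, hn]
  · exact natDegree_lt_iff_degree_lt h

open Polynomial in
theorem eq_zero_of_sq_mul_eq_mul_sq {L : Type*} [Field L] {G D E : L[X]} {κ : L}
    (hG : Squarefree G) (hdeg : 0 < G.natDegree) (hκ : κ ≠ 0)
    (h : D ^ 2 * G = C κ * E ^ 2) : E = 0 := by
  by_contra hE
  have hG0 : G ≠ 0 := by rintro rfl; simp at hdeg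
  have hD : D ≠ 0 := by
    rintro rfl
    have : C κ * E ^ 2 ≠ 0 := mul_ne_zero (by simpa using hκ) (pow_ne_zero _ hE)
    exact this (by rw [← h]; simp)
  obtain ⟨π, hπ, hπG⟩ := WfDvdMonoid.exists_irreducible_factor
    (fun hu => hdeg.ne' (natDegree_eq_zero_of_isUnit hu)) hG0
  have hp := hπ.prime
  have fin : ∀ f : L[X], f ≠ 0 → FiniteMultiplicity π f :=
    fun f hf => FiniteMultiplicity.of_not_isUnit hπ.not_isUnit hf
  have hC : C κ ≠ 0 := by simpa using hκ
  have hmG : multiplicity π G = 1 := by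
    apply le_antisymm
    · by_contra hlt
      push Not at hlt
      have : π ^ 2 ∣ G := (fin G hG0).pow_dvd_iff_le_multiplicity.2 hlt
      exact hπ.not_isUnit (hG π (by rwa [← sq]))
    · exact (fin G hG0).pow_dvd_iff_le_multiplicity.1 (by simpa using hπG)
  have hmC : multiplicity π (C κ) = 0 := by
    rw [multiplicity_eq_zero]
    exact fun hd => hπ.not_isUnit (isUnit_of_dvd_unit hd (by simpa using hκ))
  have := congrArg (multiplicity π) h
  rw [multiplicity_mul hp (fin _ (mul_ne_zero (pow_ne_zero _ hD) hG0)),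
    multiplicity_mul hp (fin _ (mul_ne_zero hC (pow_ne_zero _ hE))),
    (fin D hD).multiplicity_pow hp, (fin E hE).multiplicity_pow hp, hmG, hmC] at this
  omega

open Polynomial in
theorem forall_eq_zero_of_sum_X_pow_mul_eq_zero {L : Type*} [Field L] {R : ℕ} (n : ℕ)
    (A : ℕ → L[X]) (hA : ∀ j, X ^ R ∣ A j → A j = 0)
    (h : ∑ j ∈ Finset.range n, X ^ (j * R) * A j = 0) : ∀ j < n, A j = 0 := by
  induction n generalizing A with
  | zero => simp
  | succ n ih =>
    rw [Finset.sum_range_succ'] at h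
    have hs : ∑ j ∈ Finset.range n, (X : L[X]) ^ ((j + 1) * R) * A (j + 1) =
        X ^ R * ∑ j ∈ Finset.range n, X ^ (j * R) * A (j + 1) := by
      rw [Finset.mul_sum]
      exact Finset.sum_congr rfl fun j _ => by ring
    rw [hs] at h
    have h0 : A 0 = 0 := hA 0 ⟨-∑ j ∈ Finset.range n, X ^ (j * R) * A (j + 1), by
      linear_combination h⟩
    have := ih (fun j => A (j + 1)) (fun j => hA _) (by
      simpa [h0] using h)
    rintro (_ | j) hj
    · exact h0
    · exact this j (by omega)

open Polynomial in
theorem eq_zero_of_X_pow_dvd_add_mul_pow {L : Type*} [Field L] {p s R m : ℕ}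
    [Fact p.Prime] [CharP L p] (hR : R = p ^ s) (hodd : Odd R) {G : L[X]} (hG : Squarefree G)
    (hm : G.natDegree = m) (hm0 : 0 < m) (hG0 : G.coeff 0 ≠ 0) {B : ℕ} (hB : 2 * B + m ≤ R + 1)
    {D E : L[X]} (hD : D.degree < B) (hE : E.degree < B)
    (h : X ^ R ∣ D + E * G ^ (R / 2)) : D = 0 ∧ E = 0 := by
  have hRpos : 0 < R := hodd.pos
  have hGR : X ^ R ∣ G ^ R - C (G.coeff 0 ^ R) := by
    have h1 : X ∣ G - C (G.coeff 0) := by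
      rw [X_dvd_iff]; simp
    have h2 := pow_dvd_pow_of_dvd h1 R
    rwa [hR, sub_pow_char_pow, ← C_pow, ← hR] at h2
  have hkey : X ^ R ∣ D ^ 2 * G - C (G.coeff 0 ^ R) * E ^ 2 := by
    have e : D ^ 2 * G - C (G.coeff 0 ^ R) * E ^ 2 =
        (D + E * G ^ (R / 2)) * ((D - E * G ^ (R / 2)) * G) +
          (G ^ R - C (G.coeff 0 ^ R)) * E ^ 2 := by
      obtain ⟨r, hr⟩ := hodd
      have : R / 2 = r := by omega
      rw [this, hr]; ring
    rw [e]
    exact dvd_add (h.mul_right _) (hGR.mul_right _)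
  have nd : ∀ {f : L[X]}, f.degree < B → f = 0 ∨ f.natDegree + 1 ≤ B := by
    intro f hf
    by_cases h0 : f = 0
    · exact Or.inl h0
    · exact Or.inr ((natDegree_lt_iff_degree_lt h0).2 hf)
  have hz : D ^ 2 * G - C (G.coeff 0 ^ R) * E ^ 2 = 0 := by
    refine eq_zero_of_dvd_of_natDegree_lt hkey ?_
    rw [natDegree_X_pow]
    have b1 : (D ^ 2 * G).natDegree < R := by
      rcases nd hD with h0 | h0
      · simpa [h0] using hRpos
      · have := natDegree_mul_le (p := D ^ 2) (q := G)
        have := natDegree_pow_le (p := D) (n := 2)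
        omega
    have b2 : (C (G.coeff 0 ^ R) * E ^ 2).natDegree < R := by
      rcases nd hE with h0 | h0
      · simpa [h0] using hRpos
      · have := natDegree_C_mul_le (G.coeff 0 ^ R) (E ^ 2)
        have := natDegree_pow_le (p := E) (n := 2)
        omega
    exact lt_of_le_of_lt (natDegree_sub_le _ _) (max_lt b1 b2)
  have hE0 : E = 0 := eq_zero_of_sq_mul_eq_mul_sq hG (hm ▸ hm0) (pow_ne_zero R hG0)
    (sub_eq_zero.1 hz)
  have hGne : G ≠ 0 := by rintro rfl; simp at hG0
  refine ⟨?_, hE0⟩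
  rw [hE0] at hz
  simpa [hGne] using hz

open Polynomial in
theorem exists_stepanov_auxiliary {L : Type*} [Field L] {R B n N : ℕ}
    (P : L[X]) (hB : 0 < B) (hn : 0 < n)
    (hN : (B - 1) * R + (n - 1) + P.natDegree < N) (hdim : N < 2 * (n * B)) :
    ∃ D E : Fin n → L[X], (∀ j, (D j).degree < B) ∧ (∀ j, (E j).degree < B) ∧
      ((∃ j, D j ≠ 0) ∨ ∃ j, E j ≠ 0) ∧
      ∑ j : Fin n, X ^ (j : ℕ) * (expand L R (E j) + P * expand L R (D j)) = 0 := by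
  let Φ : (Fin n → degreeLT L B) × (Fin n → degreeLT L B) →ₗ[L] L[X] :=
    { toFun := fun v => ∑ j : Fin n, X ^ (j : ℕ) * (expand L R (v.2 j : L[X]) +
        P * expand L R (v.1 j : L[X]))
      map_add' := fun v w => by
        simp only [Prod.fst_add, Prod.snd_add, Pi.add_apply, Submodule.coe_add, map_add,
          ← Finset.sum_add_distrib]
        exact Finset.sum_congr rfl fun j _ => by ring
      map_smul' := fun c v => by
        simp only [Prod.smul_fst, Prod.smul_snd, Pi.smul_apply, Submodule.coe_smul,
          RingHom.id_apply,
          Finset.smul_sum, smul_eq_C_mul, map_mul, expand_C]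
        exact Finset.sum_congr rfl fun j _ => by ring }
  have hmem : ∀ v, Φ v ∈ degreeLT L N := by
    intro v
    change ∑ j : Fin n, X ^ (j : ℕ) * (expand L R (v.2 j : L[X]) +
        P * expand L R (v.1 j : L[X])) ∈ _
    refine Submodule.sum_mem _ fun j _ => ?_
    have ex : ∀ f : degreeLT L B, (expand L R (f : L[X])).natDegree ≤ (B - 1) * R := by
      intro f
      rw [natDegree_expand]
      refine Nat.mul_le_mul_right _ ?_
      have := natDegree_lt_iff_degree_lt_of_pos hB |>.2 (mem_degreeLT.1 f.2)
      omega
    rw [mem_degreeLT]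
    refine (natDegree_lt_iff_degree_lt_of_pos (by omega)).1 ?_
    have h1 := natDegree_mul_le (p := (X : L[X]) ^ (j : ℕ))
      (q := expand L R (v.2 j : L[X]) + P * expand L R (v.1 j : L[X]))
    have h2 := natDegree_add_le (expand L R (v.2 j : L[X])) (P * expand L R (v.1 j : L[X]))
    have h3 := natDegree_mul_le (p := P) (q := expand L R (v.1 j : L[X]))
    have h4 := ex (v.1 j)
    have h5 := ex (v.2 j)
    have h6 := j.2
    rw [natDegree_X_pow] at h1
    have h7 := h2.trans (max_le (c := (B - 1) * R + P.natDegree) (by omega) (by omega))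
    omega
  have hfr : ∀ k, Module.finrank L (degreeLT L k) = k := fun k => by
    rw [Module.finrank_eq_card_basis (degreeLT.basis L k)]; simp
  have hfin : ∀ k, FiniteDimensional L (degreeLT L k) := fun k =>
    Module.Basis.finiteDimensional_of_finite (degreeLT.basis L k)
  have hker := LinearMap.ker_ne_bot_of_finrank_lt (f := Φ.codRestrict _ hmem) (by
    rw [Module.finrank_prod, Module.finrank_pi_fintype]
    simp only [hfr, Finset.sum_const, Finset.card_univ, Fintype.card_fin, smul_eq_mul]
    omega)
  obtain ⟨v, hv, hv0⟩ := Submodule.exists_mem_ne_zero_of_ne_bot hker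
  refine ⟨fun j => v.1 j, fun j => v.2 j, fun j => mem_degreeLT.1 (v.1 j).2,
    fun j => mem_degreeLT.1 (v.2 j).2, ?_, ?_⟩
  · by_contra! hcon
    apply hv0
    ext j : 3
    · exact hcon.1 j
    · exact hcon.2 j
  · exact congrArg Subtype.val (LinearMap.mem_ker.1 hv)

open Polynomial in
theorem two_mul_card_square_values_le {L : Type*} [Field L] [Fintype L] [DecidableEq L]
    {p s R m : ℕ} [Fact p.Prime] [CharP L p] (hR : R = p ^ s) (hodd : Odd R)
    (hcard : Fintype.card L = R ^ 2) {G : L[X]} (hG : Squarefree G)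
    (hm : G.natDegree = m) (hm0 : 0 < m) (hme : Even m) (hG0 : G.coeff 0 ≠ 0)
    (hRm : 2 * m < R) :
    2 * (Finset.univ.filter fun y : L => G.eval y ≠ 0 ∧ IsSquare (G.eval y)).card ≤
      R ^ 2 + (3 * m + 2) * R := by
  obtain ⟨r, hr⟩ := hodd
  obtain ⟨m', hm'⟩ := hme
  obtain ⟨B, hB⟩ : ∃ B, B = r + 1 - m' := ⟨_, rfl⟩
  obtain ⟨n, hn⟩ : ∃ n, n = r + 2 * m' + 1 := ⟨_, rfl⟩
  set P := G ^ (R / 2) with hP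
  have hr2 : R / 2 = r := by omega
  have hPdeg : P.natDegree ≤ r * m := by
    have := natDegree_pow_le (p := G) (n := R / 2)
    rwa [hm, ← hP, hr2] at this
  have hRpos : 0 < R := by omega
  have hBpos : 0 < B := by omega
  obtain ⟨D, E, hD, hE, hne, hsum⟩ := exists_stepanov_auxiliary (R := R) (B := B) (n := n)
    (N := (B - 1) * R + (n - 1) + r * m + 1) P hBpos (by omega) (by omega) (by
      obtain ⟨t, rfl⟩ : ∃ t, r = 2 * m' + t := ⟨r - 2 * m', by omega⟩
      have : B - 1 = m' + t := by omega
      have h2 : B = m' + t + 1 := by omega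
      rw [this, h2, hr, hm', hn]
      have : 2 * m' + t + 2 * m' + 1 - 1 = 4 * m' + t := by omega
      rw [this]
      nlinarith [Nat.zero_le t, Nat.zero_le m', Nat.zero_le (t * m')])
  set φ := iterateFrobenius L p s with hφ
  have hφR : ∀ x, φ x = x ^ R := fun x => by rw [hφ, iterateFrobenius_def, hR]
  have hφφ : ∀ x, φ (φ x) = x := fun x => by
    rw [hφR, hφR, ← pow_mul, ← sq, ← hcard, FiniteField.pow_card]
  let A : ℕ → L[X] := fun j => if h : j < n then (D ⟨j, h⟩).map φ + (E ⟨j, h⟩).map φ * P else 0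
  set u := ∑ j ∈ Finset.range n, X ^ (j * R) * A j with hu
  have hdegmap : ∀ f : L[X], (f.map φ).degree = f.degree := fun f => degree_map _ _
  have hvan : ∀ (j : ℕ) (h : j < n), X ^ R ∣ A j → D ⟨j, h⟩ = 0 ∧ E ⟨j, h⟩ = 0 := by
    intro j h hd
    simp only [A, h, dif_pos] at hd
    have := eq_zero_of_X_pow_dvd_add_mul_pow hR ⟨r, hr⟩ hG hm hm0 hG0 (B := B) (by omega)
      (by rw [hdegmap]; exact hD _) (by rw [hdegmap]; exact hE _) hd
    simpa [Polynomial.map_eq_zero] using this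
  have hu0 : u ≠ 0 := by
    intro h0
    have := forall_eq_zero_of_sum_X_pow_mul_eq_zero n A (fun j hd => by
      by_cases h : j < n
      · have := hvan j h hd
        simp [A, h, this.1, this.2]
      · simp [A, h]) h0
    rcases hne with ⟨j, hj⟩ | ⟨j, hj⟩
    · exact hj (hvan j j.2 (by rw [this j j.2]; exact dvd_zero _)).1
    · exact hj (hvan j j.2 (by rw [this j j.2]; exact dvd_zero _)).2
  have hudeg : u.natDegree ≤ (n - 1) * R + (B - 1) + r * m := by
    refine natDegree_sum_le_of_forall_le _ _ fun j hj => ?_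
    have hj := Finset.mem_range.1 hj
    simp only [A, hj, dif_pos]
    have e1 := natDegree_lt_iff_degree_lt_of_pos hBpos |>.2 (hD ⟨j, hj⟩)
    have e2 := natDegree_lt_iff_degree_lt_of_pos hBpos |>.2 (hE ⟨j, hj⟩)
    have h1 := natDegree_mul_le (p := (X : L[X]) ^ (j * R))
      (q := (D ⟨j, hj⟩).map φ + (E ⟨j, hj⟩).map φ * P)
    have h2 := natDegree_add_le ((D ⟨j, hj⟩).map φ) ((E ⟨j, hj⟩).map φ * P)
    have h3 := natDegree_mul_le (p := (E ⟨j, hj⟩).map φ) (q := P)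
    rw [natDegree_map] at h2 h3
    rw [natDegree_X_pow] at h1
    have h7 := h2.trans (max_le (c := (B - 1) + r * m) (by omega) (by omega))
    have h8 : j * R ≤ (n - 1) * R := Nat.mul_le_mul_right _ (by omega)
    omega
  have heval : ∀ (f : L[X]) (y : L), (f.map φ).eval y ^ R = (expand L R f).eval y := by
    intro f y
    have : (f.map φ).eval y = φ (f.eval (φ y)) := by
      rw [← eval_map_apply, hφφ]
    rw [this, ← hφR, hφφ, expand_eval, hφR]
  have hroots : (Finset.univ.filter fun y : L => G.eval y ≠ 0 ∧ IsSquare (G.eval y)) ⊆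
      u.roots.toFinset := by
    intro y hy
    simp only [Finset.mem_filter, Finset.mem_univ, true_and] at hy
    rw [Multiset.mem_toFinset, mem_roots hu0, IsRoot]
    obtain ⟨hy0, w, hw⟩ := hy
    have hw0 : w ≠ 0 := by rintro rfl; simp [hw] at hy0
    have hPR : P.eval y ^ R * P.eval y = 1 := by
      rw [hP, hr2, eval_pow, hw, ← pow_succ, ← pow_mul, ← sq, ← pow_mul]
      have : 2 * (r * (R + 1)) = Fintype.card L - 1 := by
        rw [hcard, hr]
        have : (2 * r + 1) ^ 2 = 2 * (r * (2 * r + 1 + 1)) + 1 := by ring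
        omega
      rw [this, FiniteField.pow_card_sub_one_eq_one w hw0]
    have hP0 : P.eval y ≠ 0 := by
      intro h
      rw [h, mul_zero] at hPR
      exact zero_ne_one hPR
    have huR : φ (u.eval y) * P.eval y = 0 := by
      rw [hu, eval_finsetSum, map_sum, Finset.sum_mul, ← Fin.sum_univ_eq_sum_range
        (fun j => φ (eval y (X ^ (j * R) * A j)) * eval y P) n]
      have := congrArg (eval y) hsum
      rw [eval_finsetSum, eval_zero] at this
      rw [← this]
      refine Finset.sum_congr rfl fun j _ => ?_
      have hj : A j = (D j).map φ + (E j).map φ * P := by simp [A]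
      rw [hj]
      simp only [eval_mul, eval_add, eval_pow, eval_X, map_mul, map_add]
      rw [pow_mul, ← hφR (y ^ (j : ℕ)), hφφ, hφR, hφR, hφR, heval, heval]
      linear_combination (y ^ (j : ℕ) * eval y (expand L R (E j))) * hPR
    have := (mul_eq_zero.1 huR).resolve_right hP0
    exact (map_eq_zero φ).1 this
  have hfinal := (Finset.card_le_card hroots).trans
    ((Multiset.toFinset_card_le _).trans ((card_roots' u).trans hudeg))
  have : n - 1 = r + 2 * m' := by omega
  rw [this] at hfinal
  have : 2 * ((r + 2 * m') * R + (B - 1) + r * m) ≤ R ^ 2 + (3 * m + 2) * R := by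
    have hb : B - 1 ≤ r := by omega
    rw [hr, hm']
    nlinarith [Nat.zero_le r, Nat.zero_le m', Nat.zero_le (r * m')]
  omega

/-- The finite set of monic polynomials of degree `m`. -/
noncomputable def monicsOfDegree (F : Type*) [Field F] [Fintype F] (m : ℕ) :
    Finset (Polynomial F) :=
  open Classical in
  Finset.univ.image fun c : Fin m → F =>
    Polynomial.X ^ m + ∑ i : Fin m, Polynomial.C (c i) * Polynomial.X ^ (i : ℕ)

/-- The finite set of monic irreducible polynomials of degree `m`. -/
noncomputable def irreduciblesOfDegree (F : Type*) [Field F] [Fintype F] (m : ℕ) :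
    Finset (Polynomial F) :=
  open Classical in (monicsOfDegree F m).filter Irreducible

/-- The multiplicative function on monic polynomials with value `ψ (a s + b r)` at `f`, where `s`
is the sum of the roots of `f` and `r` the sum of their inverses; it vanishes when `f 0 = 0`. -/
noncomputable def kloostermanWeight {F : Type*} [Field F] (ψ : AddChar F ℂ) (a b : F)
    (f : Polynomial F) : ℂ :=
  open Classical in
  if f.coeff 0 = 0 then 0 else ψ (-(a * f.nextCoeff) - b * (f.coeff 1 / f.coeff 0))

/-- The sum of `kloostermanWeight` over monic polynomials of degree `m`. -/
noncomputable def weightSum {F : Type*} [Field F] [Fintype F] (ψ : AddChar F ℂ) (a b : F)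
    (m : ℕ) : ℂ :=
  ∑ f ∈ monicsOfDegree F m, kloostermanWeight ψ a b f

/-- The sum of `deg P * kloostermanWeight (P ^ i)` over prime powers `P ^ i` of degree `m`. -/
noncomputable def primePowerSum {F : Type*} [Field F] [Fintype F] (ψ : AddChar F ℂ) (a b : F)
    (m : ℕ) : ℂ :=
  ∑ x ∈ m.divisorsAntidiagonal, ∑ P ∈ irreduciblesOfDegree F x.1,
    (x.1 : ℂ) * kloostermanWeight ψ a b P ^ x.2

section weights

open Polynomial

variable {F : Type*} [Field F]

theorem coeff_X_pow_add_sum {m : ℕ} (c : Fin m → F) (j : ℕ) :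
    (X ^ m + ∑ i : Fin m, C (c i) * X ^ (i : ℕ)).coeff j =
      if h : j < m then c ⟨j, h⟩ else if j = m then 1 else 0 := by
  rw [coeff_add, finsetSum_coeff, coeff_X_pow]
  simp only [coeff_C_mul, coeff_X_pow, mul_ite, mul_one, mul_zero]
  split_ifs with h1 h2 h2
  · omega
  · rw [Finset.sum_eq_zero, add_zero]
    intro i _
    rw [if_neg]
    have := i.2
    omega
  · rw [Finset.sum_eq_single ⟨j, h2⟩]
    · simp
    · intro i _ hi
      rw [if_neg]
      intro h
      exact hi (Fin.ext h.symm)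
    · simp
  · rw [Finset.sum_eq_zero, add_zero]
    intro i _
    rw [if_neg]
    have := i.2
    omega

theorem X_pow_add_sum_injective (m : ℕ) :
    Function.Injective fun c : Fin m → F => X ^ m + ∑ i : Fin m, C (c i) * X ^ (i : ℕ) := by
  intro c c' h
  ext i
  have := congrArg (fun f => coeff f (i : ℕ)) h
  simp only [coeff_X_pow_add_sum] at this
  simpa using this

theorem mem_monicsOfDegree [Fintype F] {m : ℕ} {f : F[X]} :
    f ∈ monicsOfDegree F m ↔ f.Monic ∧ f.natDegree = m := by
  classical
  simp only [monicsOfDegree, Finset.mem_image, Finset.mem_univ, true_and]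
  constructor
  · rintro ⟨c, rfl⟩
    have hdeg : (∑ i : Fin m, C (c i) * X ^ (i : ℕ)).degree < (m : WithBot ℕ) := by
      refine (degree_lt_iff_coeff_zero _ _).2 fun j hj => ?_
      rw [finsetSum_coeff]
      refine Finset.sum_eq_zero fun i _ => ?_
      rw [coeff_C_mul, coeff_X_pow, if_neg (by have := i.2; omega), mul_zero]
    exact ⟨monic_X_pow_add hdeg, natDegree_eq_of_degree_eq_some (by
      rw [degree_add_eq_left_of_degree_lt (by rwa [degree_X_pow]), degree_X_pow])⟩
  · rintro ⟨hf, hm⟩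
    refine ⟨fun i => f.coeff i, ?_⟩
    ext j
    rw [coeff_X_pow_add_sum]
    split_ifs with h1 h2
    · rfl
    · rw [h2, ← hm]; exact hf.symm
    · exact (coeff_eq_zero_of_natDegree_lt (by omega)).symm

theorem mem_irreduciblesOfDegree [Fintype F] {m : ℕ} {f : F[X]} :
    f ∈ irreduciblesOfDegree F m ↔ f.Monic ∧ f.natDegree = m ∧ Irreducible f := by
  classical
  rw [irreduciblesOfDegree, Finset.mem_filter, mem_monicsOfDegree, and_assoc]

theorem sum_monicsOfDegree [Fintype F] (m : ℕ) (g : F[X] → ℂ) :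
    ∑ f ∈ monicsOfDegree F m, g f =
      ∑ c : Fin m → F, g (X ^ m + ∑ i : Fin m, C (c i) * X ^ (i : ℕ)) := by
  classical
  rw [monicsOfDegree, Finset.sum_image fun _ _ _ _ h => X_pow_add_sum_injective m h]

variable (ψ : AddChar F ℂ) (a b : F)

theorem kloostermanWeight_one : kloostermanWeight ψ a b 1 = 1 := by
  classical
  have h1 : (1 : F[X]).coeff 1 = 0 := by rw [coeff_one]; simp
  have h2 : (1 : F[X]).nextCoeff = 0 := by simp [nextCoeff]
  simp [kloostermanWeight, h1, h2]

theorem kloostermanWeight_mul {f g : F[X]} (hf : f.Monic) (hg : g.Monic) :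
    kloostermanWeight ψ a b (f * g) = kloostermanWeight ψ a b f * kloostermanWeight ψ a b g := by
  classical
  rw [kloostermanWeight, kloostermanWeight, kloostermanWeight, mul_coeff_zero]
  by_cases h1 : f.coeff 0 = 0
  · simp [h1]
  by_cases h2 : g.coeff 0 = 0
  · simp [h2]
  rw [if_neg (mul_ne_zero h1 h2), if_neg h1, if_neg h2, ← AddChar.map_add_eq_mul,
    hf.nextCoeff_mul hg, mul_coeff_one]
  congr 1
  field_simp
  ring

theorem kloostermanWeight_pow {f : F[X]} (hf : f.Monic) (i : ℕ) :
    kloostermanWeight ψ a b (f ^ i) = kloostermanWeight ψ a b f ^ i := by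
  induction i with
  | zero => simp [kloostermanWeight_one]
  | succ i ih => rw [pow_succ, kloostermanWeight_mul ψ a b (hf.pow i) hf, ih, pow_succ]

variable [Fintype F]

theorem sum_dvd_kloostermanWeight {P : F[X]} {e i m : ℕ} (hP : P.Monic) (he : P.natDegree = e) :
    (open Classical in ∑ f ∈ monicsOfDegree F m,
      if P ^ i ∣ f then kloostermanWeight ψ a b f else 0) =
      if e * i ≤ m then kloostermanWeight ψ a b P ^ i * weightSum ψ a b (m - e * i) else 0 := by
  classical
  have hPi : (P ^ i).Monic := hP.pow i
  have hdeg : (P ^ i).natDegree = e * i := by rw [hP.natDegree_pow, he, mul_comm]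
  rw [← Finset.sum_filter]
  split_ifs with h
  · rw [weightSum, Finset.mul_sum]
    symm
    refine Finset.sum_bij (fun g _ => P ^ i * g) ?_ ?_ ?_ ?_
    · intro g hg
      obtain ⟨h1, h2⟩ := mem_monicsOfDegree.1 hg
      rw [Finset.mem_filter, mem_monicsOfDegree]
      refine ⟨⟨hPi.mul h1, ?_⟩, dvd_mul_right _ _⟩
      rw [hPi.natDegree_mul h1, hdeg, h2]
      omega
    · intro g _ g' _ hgg
      exact mul_left_cancel₀ hPi.ne_zero hgg
    · intro f hf
      rw [Finset.mem_filter, mem_monicsOfDegree] at hf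
      obtain ⟨⟨h1, h2⟩, g, rfl⟩ := hf
      have hg := hPi.of_mul_monic_left h1
      refine ⟨g, mem_monicsOfDegree.2 ⟨hg, ?_⟩, rfl⟩
      rw [hPi.natDegree_mul hg, hdeg] at h2
      omega
    · intro g hg
      rw [kloostermanWeight_mul ψ a b hPi (mem_monicsOfDegree.1 hg).1,
        kloostermanWeight_pow ψ a b hP]
  · refine Finset.sum_eq_zero fun f hf => ?_
    rw [Finset.mem_filter, mem_monicsOfDegree] at hf
    exfalso
    have := natDegree_le_of_dvd hf.2 hf.1.1.ne_zero
    omega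

theorem degree_eq_sum_prime_powers {f : F[X]} {m : ℕ} (hf : f ∈ monicsOfDegree F m) :
    (open Classical in ∑ e ∈ Finset.Icc 1 m, ∑ i ∈ Finset.Icc 1 m,
      ∑ P ∈ irreduciblesOfDegree F e, if P ^ i ∣ f then (e : ℂ) else 0) = m := by
  classical
  obtain ⟨hmon, hm⟩ := mem_monicsOfDegree.1 hf
  have hf0 := hmon.ne_zero
  set N := UniqueFactorizationMonoid.normalizedFactors f with hN
  have hNm : ∀ P, P ∈ N ↔ Irreducible P ∧ P.Monic ∧ P ∣ f :=
    fun P => Polynomial.mem_normalizedFactors_iff hf0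
  have hdeg : (m : ℂ) = ∑ P ∈ N.toFinset, (Multiset.count P N : ℂ) * P.natDegree := by
    have h1 : N.prod = f := by
      rw [hN, UniqueFactorizationMonoid.prod_normalizedFactors_eq hf0, hmon.normalize_eq_self]
    have h2 := natDegree_multiset_prod_of_monic N fun P hP => ((hNm P).1 hP).2.1
    rw [h1, hm, Finset.sum_multiset_map_count] at h2
    rw [h2]
    push_cast
    simp
  have hcount : ∀ P : F[X], Irreducible P → P.Monic → ∀ i : ℕ,
      P ^ i ∣ f ↔ i ≤ Multiset.count P N := by
    intro P hP hPm i
    rw [UniqueFactorizationMonoid.dvd_iff_normalizedFactors_le_normalizedFactors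
      (pow_ne_zero _ hP.ne_zero) hf0, UniqueFactorizationMonoid.normalizedFactors_pow,
      UniqueFactorizationMonoid.normalizedFactors_irreducible hP, hPm.normalize_eq_self,
      Multiset.nsmul_singleton, ← Multiset.le_count_iff_replicate_le]
  have hle : ∀ P : F[X], Irreducible P → P.Monic → Multiset.count P N ≤ m := by
    intro P hP hPm
    have h1 := natDegree_le_of_dvd ((hcount P hP hPm _).2 le_rfl) hf0
    rw [hPm.natDegree_pow, hm] at h1
    have := hP.natDegree_pos
    nlinarith
  have hinner : ∀ P : F[X], Irreducible P → P.Monic →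
      (∑ i ∈ Finset.Icc 1 m, if P ^ i ∣ f then (P.natDegree : ℂ) else 0) =
        (Multiset.count P N : ℂ) * P.natDegree := by
    intro P hP hPm
    rw [← Finset.sum_filter, Finset.sum_const, nsmul_eq_mul]
    congr 2
    have : (Finset.Icc 1 m).filter (fun i => P ^ i ∣ f) = Finset.Icc 1 (Multiset.count P N) := by
      ext i
      rw [Finset.mem_filter, Finset.mem_Icc, Finset.mem_Icc, hcount P hP hPm]
      have := hle P hP hPm
      omega
    rw [this, Nat.card_Icc]
    omega
  rw [hdeg]
  have hswap : ∀ e ∈ Finset.Icc 1 m, (∑ i ∈ Finset.Icc 1 m,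
      ∑ P ∈ irreduciblesOfDegree F e, if P ^ i ∣ f then (e : ℂ) else 0) =
      ∑ P ∈ N.toFinset with P.natDegree = e, (Multiset.count P N : ℂ) * P.natDegree := by
    intro e _
    rw [Finset.sum_comm]
    symm
    have hsub : (N.toFinset.filter fun P => P.natDegree = e) ⊆ irreduciblesOfDegree F e := by
      intro P hP
      rw [Finset.mem_filter, Multiset.mem_toFinset, hNm] at hP
      exact mem_irreduciblesOfDegree.2 ⟨hP.1.2.1, hP.2, hP.1.1⟩
    rw [← Finset.sum_subset hsub (f := fun P => ∑ i ∈ Finset.Icc 1 m,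
      if P ^ i ∣ f then (e : ℂ) else 0)]
    · refine Finset.sum_congr rfl fun P hP => ?_
      rw [Finset.mem_filter, Multiset.mem_toFinset, hNm] at hP
      rw [← hinner P hP.1.1 hP.1.2.1, hP.2]
    · intro P hP hPn
      obtain ⟨h1, h2, h3⟩ := mem_irreduciblesOfDegree.1 hP
      have := hinner P h3 h1
      rw [h2] at this
      rw [this, Multiset.count_eq_zero_of_notMem, Nat.cast_zero, zero_mul]
      intro hPN
      exact hPn (Finset.mem_filter.2 ⟨Multiset.mem_toFinset.2 hPN, h2⟩)
  rw [Finset.sum_congr rfl hswap]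
  refine Finset.sum_fiberwise_of_maps_to (fun P hP => ?_) _
  rw [Multiset.mem_toFinset, hNm] at hP
  rw [Finset.mem_Icc, ← hm]
  exact ⟨hP.1.natDegree_pos, natDegree_le_of_dvd hP.2.2 hf0⟩

theorem mul_weightSum (m : ℕ) :
    (m : ℂ) * weightSum ψ a b m =
      ∑ j ∈ Finset.Icc 1 m, primePowerSum ψ a b j * weightSum ψ a b (m - j) := by
  classical
  let T : ℕ × ℕ → ℂ := fun x => ∑ P ∈ irreduciblesOfDegree F x.1,
    (x.1 : ℂ) * (kloostermanWeight ψ a b P ^ x.2 * weightSum ψ a b (m - x.1 * x.2))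
  have hL : (m : ℂ) * weightSum ψ a b m =
      ∑ x ∈ (Finset.Icc 1 m ×ˢ Finset.Icc 1 m).filter (fun x => x.1 * x.2 ≤ m), T x := by
    rw [weightSum, Finset.mul_sum]
    have : ∀ f ∈ monicsOfDegree F m, (m : ℂ) * kloostermanWeight ψ a b f =
        ∑ e ∈ Finset.Icc 1 m, ∑ i ∈ Finset.Icc 1 m, ∑ P ∈ irreduciblesOfDegree F e,
          (e : ℂ) * if P ^ i ∣ f then kloostermanWeight ψ a b f else 0 := by
      intro f hf
      rw [← degree_eq_sum_prime_powers hf]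
      simp only [Finset.sum_mul]
      refine Finset.sum_congr rfl fun e _ => Finset.sum_congr rfl fun i _ =>
        Finset.sum_congr rfl fun P _ => ?_
      split_ifs <;> simp
    rw [Finset.sum_congr rfl this, Finset.sum_comm, Finset.sum_filter, Finset.sum_product]
    refine Finset.sum_congr rfl fun e _ => ?_
    rw [Finset.sum_comm]
    refine Finset.sum_congr rfl fun i _ => ?_
    rw [Finset.sum_comm]
    simp only [T]
    have h2 : ∀ P ∈ irreduciblesOfDegree F e, (∑ f ∈ monicsOfDegree F m,
        (e : ℂ) * if P ^ i ∣ f then kloostermanWeight ψ a b f else 0) =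
        (e : ℂ) * if e * i ≤ m then
          kloostermanWeight ψ a b P ^ i * weightSum ψ a b (m - e * i) else 0 := by
      intro P hP
      obtain ⟨h1, h2, h3⟩ := mem_irreduciblesOfDegree.1 hP
      rw [← Finset.mul_sum, ← sum_dvd_kloostermanWeight ψ a b h1 h2]
    rw [Finset.sum_congr rfl h2]
    split_ifs <;> simp
  rw [hL, ← Finset.sum_fiberwise_of_maps_to (g := fun x : ℕ × ℕ => x.1 * x.2)
    (t := Finset.Icc 1 m)]
  · refine Finset.sum_congr rfl fun j hj => ?_
    rw [Finset.mem_Icc] at hj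
    rw [primePowerSum, Finset.sum_mul]
    have hset : ((Finset.Icc 1 m ×ˢ Finset.Icc 1 m).filter (fun x => x.1 * x.2 ≤ m)).filter
        (fun x => x.1 * x.2 = j) = j.divisorsAntidiagonal := by
      ext ⟨e, i⟩
      simp only [Finset.mem_filter, Finset.mem_product, Finset.mem_Icc,
        Nat.mem_divisorsAntidiagonal]
      constructor
      · rintro ⟨_, h⟩
        exact ⟨h, by omega⟩
      · rintro ⟨h, _⟩
        have he : e ≠ 0 := by rintro rfl; omega
        have hi : i ≠ 0 := by rintro rfl; omega
        have := Nat.le_mul_of_pos_right e (Nat.pos_of_ne_zero hi)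
        have := Nat.le_mul_of_pos_left i (Nat.pos_of_ne_zero he)
        omega
    rw [hset]
    refine Finset.sum_congr rfl fun x hx => ?_
    rw [Finset.sum_mul]
    refine Finset.sum_congr rfl fun P _ => ?_
    rw [(Nat.mem_divisorsAntidiagonal.1 hx).1, mul_assoc]
  · rintro ⟨e, i⟩ hx
    simp only [Finset.mem_filter, Finset.mem_product, Finset.mem_Icc] at hx ⊢
    exact ⟨Nat.mul_pos hx.1.1.1 hx.1.2.1, hx.2⟩

end weights

/-- The Kloosterman sum over the extension `L` of `F` attached to the additive character
`ψ ∘ Tr`. -/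
noncomputable def kloosterman {F : Type*} [Field F] (L : Type*) [Field L] [Fintype L] [Algebra F L]
    (ψ : AddChar F ℂ) (a b : F) : ℂ :=
  open Classical in
  ∑ x : L, if x = 0 then 0 else ψ (a * Algebra.trace F L x + b * Algebra.trace F L x⁻¹)

section lfunction

open Polynomial

variable {F : Type*} [Field F]

theorem minpoly_inv_nextCoeff {L : Type*} [Field L] [Algebra F L] [FiniteDimensional F L]
    {x : L} (hx : x ≠ 0) :
    (minpoly F x⁻¹).nextCoeff = (minpoly F x).coeff 1 / (minpoly F x).coeff 0 := by
  have hx_integral : IsIntegral F x := IsIntegral.of_finite F x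
  have hx_integral' : IsIntegral F x⁻¹ := IsIntegral.of_finite F x⁻¹
  have hc0 : (minpoly F x).coeff 0 ≠ 0 := minpoly.coeff_zero_ne_zero hx_integral hx
  set f := minpoly F x with hf
  have hadj : IntermediateField.adjoin F {x⁻¹} = IntermediateField.adjoin F {x} := by
    apply le_antisymm <;> rw [IntermediateField.adjoin_simple_le_iff]
    · exact inv_mem (IntermediateField.mem_adjoin_simple_self F x)
    · have := inv_mem (IntermediateField.mem_adjoin_simple_self F x⁻¹)
      rwa [inv_inv] at this
  have hdeg : (minpoly F x⁻¹).natDegree = f.natDegree := by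
    rw [← IntermediateField.adjoin.finrank hx_integral',
      ← IntermediateField.adjoin.finrank hx_integral, hadj]
  have hpos : 0 < f.natDegree := minpoly.natDegree_pos hx_integral
  have hrdeg : f.reverse.natDegree = f.natDegree := by
    rw [reverse_natDegree, natTrailingDegree_eq_zero.2 (Or.inr hc0), Nat.sub_zero]
  have hlead : f.reverse.leadingCoeff = f.coeff 0 := by
    rw [leadingCoeff, hrdeg, coeff_reverse, revAt_le le_rfl, Nat.sub_self]
  have hr0 : f.reverse ≠ 0 := by
    intro h
    rw [h] at hlead
    exact hc0 (by simpa using hlead.symm)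
  have hroot : aeval x⁻¹ f.reverse = 0 := by
    let := invertibleOfNonzero hx
    have := (eval₂_reverse_eq_zero_iff (algebraMap F L) x f).2 (minpoly.aeval F x)
    rwa [invOf_eq_inv] at this
  have heq : f.reverse * C (f.coeff 0)⁻¹ = minpoly F x⁻¹ := by
    rw [← hlead]
    refine minpoly.unique_of_degree_le_degree_minpoly F x⁻¹ (monic_mul_leadingCoeff_inv hr0) ?_ ?_
    · rw [map_mul, hroot, zero_mul]
    · rw [degree_mul_leadingCoeff_inv _ hr0, degree_eq_natDegree hr0,
        degree_eq_natDegree (minpoly.ne_zero hx_integral'), hdeg, hrdeg]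
  rw [nextCoeff_of_natDegree_pos (hdeg ▸ hpos), hdeg, ← heq, coeff_mul_C, coeff_reverse,
    revAt_le (by omega), div_eq_mul_inv]
  congr 2
  omega

variable (ψ : AddChar F ℂ) (a b : F)

theorem kloostermanWeight_minpoly_pow {L : Type*} [Field L] [Algebra F L] [FiniteDimensional F L]
    {x : L} (hx : x ≠ 0) {i : ℕ} (hi : (minpoly F x).natDegree * i = Module.finrank F L) :
    kloostermanWeight ψ a b (minpoly F x) ^ i =
      ψ (a * Algebra.trace F L x + b * Algebra.trace F L x⁻¹) := by
  have hx_integral : IsIntegral F x := IsIntegral.of_finite F x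
  have hadj : IntermediateField.adjoin F {x⁻¹} = IntermediateField.adjoin F {x} := by
    apply le_antisymm <;> rw [IntermediateField.adjoin_simple_le_iff]
    · exact inv_mem (IntermediateField.mem_adjoin_simple_self F x)
    · have := inv_mem (IntermediateField.mem_adjoin_simple_self F x⁻¹)
      rwa [inv_inv] at this
  have hfr : Module.finrank (IntermediateField.adjoin F {x}) L = i := by
    have h1 := Module.finrank_mul_finrank F (IntermediateField.adjoin F {x}) L
    rw [IntermediateField.adjoin.finrank hx_integral, ← hi] at h1
    exact Nat.eq_of_mul_eq_mul_left (minpoly.natDegree_pos hx_integral) h1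
  have hc0 : (minpoly F x).coeff 0 ≠ 0 := minpoly.coeff_zero_ne_zero hx_integral hx
  rw [kloostermanWeight, if_neg hc0, ← AddChar.map_nsmul_eq_pow,
    trace_eq_finrank_mul_minpoly_nextCoeff F x, trace_eq_finrank_mul_minpoly_nextCoeff F x⁻¹,
    hadj, hfr, minpoly_inv_nextCoeff hx, nsmul_eq_mul]
  congr 1
  ring

variable [Fintype F]

theorem card_filter_minpoly_eq {L : Type*} [Field L] [Fintype L] [Algebra F L] {P : F[X]}
    (hP : P.Monic) (hirr : Irreducible P) (hdvd : P.natDegree ∣ Module.finrank F L) :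
    (open Classical in Finset.univ.filter fun x : L => minpoly F x = P).card = P.natDegree := by
  classical
  have hsplit : (P.map (algebraMap F L)).Splits := by
    have h1 := (hirr.natDegree_dvd_iff_dvd_X_pow_card_pow_sub_X).1 hdvd
    rw [← Module.natCard_eq_pow_finrank, Nat.card_eq_fintype_card] at h1
    have := FiniteField.isSplittingField_sub L F
    refine Splits.of_dvd (IsSplittingField.splits L (X ^ Fintype.card L - X : F[X])) ?_
      (map_dvd (algebraMap F L) h1)
    exact map_ne_zero (FiniteField.X_pow_card_sub_X_ne_zero _ Fintype.one_lt_card)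
  rw [← card_rootSet_eq_natDegree (PerfectField.separable_of_irreducible hirr) hsplit,
    ← Set.toFinset_card]
  congr 1
  ext x
  rw [Finset.mem_filter, Set.mem_toFinset, mem_rootSet_of_ne hP.ne_zero]
  constructor
  · rintro ⟨_, rfl⟩
    exact minpoly.aeval F x
  · intro h
    exact ⟨Finset.mem_univ _, (minpoly.eq_of_irreducible_of_monic hirr h hP).symm⟩

theorem primePowerSum_finrank (L : Type*) [Field L] [Fintype L] [Algebra F L] :
    primePowerSum ψ a b (Module.finrank F L) = kloosterman L ψ a b := by
  classical
  have hfd : FiniteDimensional F L := Module.Finite.of_finite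
  set n := Module.finrank F L with hn
  have hn0 : n ≠ 0 := Module.finrank_pos.ne'
  have h1 : primePowerSum ψ a b n = ∑ y ∈ n.divisorsAntidiagonal,
      ∑ P ∈ irreduciblesOfDegree F y.1, ∑ x : L,
        if minpoly F x = P then kloostermanWeight ψ a b P ^ y.2 else 0 := by
    refine Finset.sum_congr rfl fun y hy => Finset.sum_congr rfl fun P hP => ?_
    obtain ⟨h1, h2, h3⟩ := mem_irreduciblesOfDegree.1 hP
    rw [← Finset.sum_filter, Finset.sum_const, nsmul_eq_mul, card_filter_minpoly_eq h1 h3, h2]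
    rw [h2, ← hn, ← (Nat.mem_divisorsAntidiagonal.1 hy).1]
    exact dvd_mul_right _ _
  rw [h1, kloosterman]
  simp_rw [Finset.sum_comm (t := (Finset.univ : Finset L))]
  refine Finset.sum_congr rfl fun x _ => ?_
  have hx_integral : IsIntegral F x := IsIntegral.of_finite F x
  obtain ⟨i, hi⟩ := minpoly.degree_dvd hx_integral
  have hi0 : i ≠ 0 := by
    rintro rfl
    exact hn0 (by rw [hn, hi, mul_zero])
  have hdpos := minpoly.natDegree_pos hx_integral
  rw [Finset.sum_eq_single ((minpoly F x).natDegree, i)]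
  · rw [Finset.sum_eq_single (minpoly F x)]
    · rw [if_pos rfl]
      split_ifs with hx
      · rw [hx, minpoly.zero, kloostermanWeight, if_pos (by simp), zero_pow hi0]
      · exact kloostermanWeight_minpoly_pow ψ a b hx hi.symm
    · intro P _ hP
      rw [if_neg hP.symm]
    · intro h
      exact absurd (mem_irreduciblesOfDegree.2
        ⟨minpoly.monic hx_integral, rfl, minpoly.irreducible hx_integral⟩) h
  · rintro ⟨e, j⟩ hy hne
    refine Finset.sum_eq_zero fun P hP => if_neg ?_
    rintro rfl
    apply hne
    have he : (minpoly F x).natDegree = e := (mem_irreduciblesOfDegree.1 hP).2.1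
    have hj : e * j = n := (Nat.mem_divisorsAntidiagonal.1 hy).1
    rw [hn, hi, he] at hj
    rw [he] at hdpos ⊢
    rw [Nat.eq_of_mul_eq_mul_left hdpos hj]
  · intro h
    exact absurd (Nat.mem_divisorsAntidiagonal.2 ⟨hi.symm, hn0⟩) h

theorem weightSum_zero : weightSum ψ a b 0 = 1 := by
  rw [weightSum, sum_monicsOfDegree]
  simp [kloostermanWeight_one]

theorem weightSum_one : weightSum ψ a b 1 = primePowerSum ψ a b 1 := by
  have := mul_weightSum ψ a b 1
  simpa [weightSum_zero] using this

theorem kloostermanWeight_X_pow_add_sum {m : ℕ} (hm : 2 ≤ m) (c : Fin m → F) :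
    kloostermanWeight ψ a b (X ^ m + ∑ i : Fin m, C (c i) * X ^ (i : ℕ)) =
      open Classical in if c ⟨0, by omega⟩ = 0 then 0 else
        ψ (-(a * c ⟨m - 1, by omega⟩) - b * (c ⟨1, by omega⟩ / c ⟨0, by omega⟩)) := by
  classical
  have hdeg : (X ^ m + ∑ i : Fin m, C (c i) * X ^ (i : ℕ)).natDegree = m :=
    (mem_monicsOfDegree.1 (by
      rw [monicsOfDegree]
      exact Finset.mem_image_of_mem _ (Finset.mem_univ c))).2
  rw [kloostermanWeight, nextCoeff_of_natDegree_pos (by omega), hdeg, coeff_X_pow_add_sum,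
    coeff_X_pow_add_sum, coeff_X_pow_add_sum, dif_pos, dif_pos, dif_pos]

variable {ψ a b}

theorem weightSum_two (hψ : ψ.IsPrimitive) (ha : a ≠ 0) (hb : b ≠ 0) :
    weightSum ψ a b 2 = Fintype.card F := by
  classical
  rw [weightSum, sum_monicsOfDegree]
  simp_rw [kloostermanWeight_X_pow_add_sum ψ a b le_rfl]
  rw [Fintype.sum_equiv (finTwoArrowEquiv F) _ (fun x : F × F => if x.1 = 0 then (0 : ℂ) else
    ψ (x.2 * (-a - b / x.1)))]
  · rw [Fintype.sum_prod_type]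
    rw [Finset.sum_eq_single (-b / a)]
    · have h1 : -b / a ≠ 0 := div_ne_zero (neg_ne_zero.2 hb) ha
      have h2 : -a - b / (-b / a) = 0 := by field_simp; ring
      simp [h1, h2]
    · intro c _ hc
      by_cases h0 : c = 0
      · simp [h0]
      simp only [h0, if_false]
      rw [AddChar.sum_mulShift _ hψ, if_neg, Nat.cast_zero]
      intro h
      apply hc
      field_simp at h ⊢
      linear_combination -h
    · simp
  · intro c
    change (if c 0 = 0 then (0 : ℂ) else ψ (-(a * c 1) - b * (c 1 / c 0))) =
      if c 0 = 0 then (0 : ℂ) else ψ (c 1 * (-a - b / c 0))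
    split_ifs
    · rfl
    · congr 1
      ring

theorem weightSum_of_three_le (hψ : ψ.IsPrimitive) (ha : a ≠ 0) {m : ℕ} (hm : 3 ≤ m) :
    weightSum ψ a b m = 0 := by
  classical
  rw [weightSum, sum_monicsOfDegree]
  simp_rw [kloostermanWeight_X_pow_add_sum ψ a b (show 2 ≤ m by omega)]
  obtain ⟨e, he⟩ : ∃ e, ψ (-(a * e)) ≠ 1 := by
    by_contra! h
    apply hψ (neg_ne_zero.2 ha)
    ext e
    rw [AddChar.mulShift_apply, neg_mul, h, AddChar.one_apply]
  set S := ∑ c : Fin m → F, (if c ⟨0, by omega⟩ = 0 then (0 : ℂ) else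
    ψ (-(a * c ⟨m - 1, by omega⟩) - b * (c ⟨1, by omega⟩ / c ⟨0, by omega⟩))) with hS
  have key : S = ψ (-(a * e)) * S := by
    rw [hS, Finset.mul_sum]
    rw [← Equiv.sum_comp (Equiv.addRight (Pi.single (⟨m - 1, by omega⟩ : Fin m) e))]
    refine Finset.sum_congr rfl fun c _ => ?_
    have h0 : (⟨0, by omega⟩ : Fin m) ≠ ⟨m - 1, by omega⟩ := by
      simp only [ne_eq, Fin.mk.injEq]; omega
    have h1 : (⟨1, by omega⟩ : Fin m) ≠ ⟨m - 1, by omega⟩ := by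
      simp only [ne_eq, Fin.mk.injEq]; omega
    simp only [Equiv.coe_addRight, Pi.add_apply, Pi.single_eq_same, Pi.single_eq_of_ne h0,
      Pi.single_eq_of_ne h1, add_zero]
    split_ifs
    · rw [mul_zero]
    · rw [← AddChar.map_add_eq_mul]
      congr 1
      ring
  have : (1 - ψ (-(a * e))) * S = 0 := by linear_combination key
  exact (mul_eq_zero.1 this).resolve_left (sub_ne_zero.2 he.symm)

theorem primePowerSum_two (hψ : ψ.IsPrimitive) (ha : a ≠ 0) (hb : b ≠ 0) :
    primePowerSum ψ a b 2 = 2 * Fintype.card F - primePowerSum ψ a b 1 ^ 2 := by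
  have := mul_weightSum ψ a b 2
  rw [Finset.sum_Icc_succ_top (by norm_num), Finset.Icc_self, Finset.sum_singleton] at this
  norm_num [weightSum_zero, weightSum_one, weightSum_two hψ ha hb] at this
  linear_combination -this

theorem primePowerSum_add_three (hψ : ψ.IsPrimitive) (ha : a ≠ 0) (hb : b ≠ 0) (m : ℕ) :
    primePowerSum ψ a b (m + 3) = -primePowerSum ψ a b 1 * primePowerSum ψ a b (m + 2) -
      Fintype.card F * primePowerSum ψ a b (m + 1) := by
  have := mul_weightSum ψ a b (m + 3)
  rw [weightSum_of_three_le hψ ha (by omega), Finset.sum_Icc_succ_top (by omega),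
    Finset.sum_Icc_succ_top (by omega), Finset.sum_Icc_succ_top (by omega),
    Finset.sum_eq_zero] at this
  · rw [show m + 3 - (m + 2 + 1) = 0 by omega, show m + 3 - (m + 1 + 1) = 1 by omega,
      show m + 3 - (m + 1) = 2 by omega, weightSum_zero, weightSum_one,
      weightSum_two hψ ha hb] at this
    linear_combination -this
  · intro j hj
    rw [Finset.mem_Icc] at hj
    rw [weightSum_of_three_le hψ ha (by omega), mul_zero]

theorem primePowerSum_eq_neg_pow_add_pow (hψ : ψ.IsPrimitive) (ha : a ≠ 0) (hb : b ≠ 0) {α β : ℂ}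
    (hsum : α + β = -primePowerSum ψ a b 1) (hprod : α * β = Fintype.card F) (n : ℕ) :
    primePowerSum ψ a b (n + 1) = -(α ^ (n + 1) + β ^ (n + 1)) := by
  induction n using Nat.strong_induction_on with
  | _ n ih =>
    match n, ih with
    | 0, _ => linear_combination hsum
    | 1, _ =>
      rw [primePowerSum_two hψ ha hb, ← hprod, ← neg_sq (primePowerSum ψ a b 1), ← hsum]
      ring
    | n + 2, ih =>
      rw [primePowerSum_add_three hψ ha hb, ih (n + 1) (by omega), ih n (by omega), ← hprod,
        ← hsum]
      ring

end lfunction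

section artinSchreier

open Polynomial

theorem natDegree_X_pow_sub_X_sq_sub_C {L : Type*} [Field L] {q : ℕ} (hq : 1 < q) (c : L) :
    ((X ^ q - X) ^ 2 - C c : L[X]).natDegree = 2 * q := by
  rw [natDegree_sub_C, natDegree_pow, FiniteField.X_pow_card_sub_X_natDegree_eq L hq]

theorem separable_X_pow_sub_X_sq_sub_C {L : Type*} [Field L] {q : ℕ} (hq : (q : L) = 0)
    (h2 : (2 : L) ≠ 0) {c : L} (hc : c ≠ 0) : ((X ^ q - X) ^ 2 - C c : L[X]).Separable := by
  have hd : derivative ((X ^ q - X) ^ 2 - C c : L[X]) = -(C 2 * (X ^ q - X)) := by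
    rw [derivative_sub, derivative_C, derivative_sq, derivative_sub, derivative_X_pow, hq,
      derivative_X, C_0]
    ring
  rw [separable_def, hd]
  refine ⟨-C c⁻¹, -(C (2⁻¹ * c⁻¹) * (X ^ q - X)), ?_⟩
  have h1 : (C c⁻¹ * C c : L[X]) = 1 := by rw [← C_mul, inv_mul_cancel₀ hc, C_1]
  have h3 : (C (2⁻¹ * c⁻¹) * C 2 : L[X]) = C c⁻¹ := by
    rw [← C_mul]; congr 1; field_simp
  linear_combination h1 + (X ^ q - X) ^ 2 * h3

/-- Most values of `(y ^ q - y) ^ 2 - c` are split evenly between squares and nonsquares. -/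
theorem le_two_mul_card_isSquare_artinSchreier {L : Type*} [Field L] [Fintype L] [DecidableEq L]
    {p s R q : ℕ} [Fact p.Prime] [CharP L p] (hR : R = p ^ s) (hodd : Odd R)
    (hcard : Fintype.card L = R ^ 2) (hq : 1 < q) (hq0 : (q : L) = 0) (hqR : 4 * q < R)
    {c : L} (hc : c ≠ 0) :
    R ^ 2 ≤ 2 * (Finset.univ.filter fun y : L =>
      (y ^ q - y) ^ 2 - c ≠ 0 ∧ IsSquare ((y ^ q - y) ^ 2 - c)).card + (6 * q + 2) * R + 4 * q := by
  have hchar : ringChar L ≠ 2 := by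
    intro h
    have h1 := FiniteField.even_card_iff_char_two.1 h
    rw [hcard] at h1
    have h3 := Nat.odd_iff.1 (hodd.pow (n := 2))
    omega
  have h2 : (2 : L) ≠ 0 := Ring.two_ne_zero hchar
  obtain ⟨γ, hγ⟩ := FiniteField.exists_nonsquare hchar
  have hγ0 : γ ≠ 0 := by rintro rfl; exact hγ IsSquare.zero
  set g : L[X] := (X ^ q - X) ^ 2 - C c with hg
  have hge (y : L) : (y ^ q - y) ^ 2 - c = g.eval y := by simp [hg]
  have hgdeg : g.natDegree = 2 * q := natDegree_X_pow_sub_X_sq_sub_C hq c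
  have hg0 : g ≠ 0 := by
    intro h
    rw [h, natDegree_zero] at hgdeg
    omega
  have hsep : (C γ * g).Separable :=
    (separable_X_pow_sub_X_sq_sub_C hq0 h2 hc).unit_mul (isUnit_C.2 hγ0.isUnit)
  have hS := two_mul_card_square_values_le hR hodd hcard hsep.squarefree
    ((natDegree_C_mul hγ0).trans hgdeg) (by omega) (even_two_mul q)
    (by
      rw [coeff_zero_eq_eval_zero, eval_mul, eval_C, ← hge, zero_pow (by omega)]
      simp [hγ0, hc]) (by omega)
  have hroots : (Finset.univ.filter fun y : L => g.eval y = 0).card ≤ 2 * q := by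
    rw [← hgdeg]
    refine le_trans (Finset.card_le_card fun y hy => ?_) (card_le_degree_of_subset_roots
      (p := g) (Z := g.roots.toFinset) (by simp))
    simpa [hg0] using hy
  simp only [hge]
  have hpart : R ^ 2 ≤ (Finset.univ.filter fun y : L => g.eval y ≠ 0 ∧ IsSquare (g.eval y)).card +
      (Finset.univ.filter fun y : L =>
        (C γ * g).eval y ≠ 0 ∧ IsSquare ((C γ * g).eval y)).card +
      (Finset.univ.filter fun y : L => g.eval y = 0).card := by
    rw [← hcard, ← Finset.card_univ]
    refine (Finset.card_le_card fun y _ => ?_).trans ((Finset.card_union_le _ _).trans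
      (Nat.add_le_add_right (Finset.card_union_le _ _) _))
    simp only [Finset.mem_union, Finset.mem_filter, Finset.mem_univ, true_and, eval_mul, eval_C]
    by_cases h0 : g.eval y = 0
    · exact Or.inr h0
    by_cases hsq : IsSquare (g.eval y)
    · exact Or.inl (Or.inl ⟨h0, hsq⟩)
    · refine Or.inl (Or.inr ⟨mul_ne_zero hγ0 h0, ?_⟩)
      have h1 := quadraticChar_neg_one_iff_not_isSquare.2 hγ
      have h2 := quadraticChar_neg_one_iff_not_isSquare.2 hsq
      rw [← quadraticChar_one_iff_isSquare (mul_ne_zero hγ0 h0), map_mul, h1, h2]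
      norm_num
  have e1 : (3 * (2 * q) + 2) * R = (6 * q + 2) * R := by ring
  rw [e1] at hS
  omega

theorem card_filter_pow_sub_self_eq_le {L : Type*} [Field L] [Fintype L] [DecidableEq L] {q : ℕ}
    (hq : 1 < q) (w : L) : (Finset.univ.filter fun y : L => y ^ q - y = w).card ≤ q := by
  have hdeg : (X ^ q - X - C w : L[X]).natDegree = q := by
    rw [natDegree_sub_C, FiniteField.X_pow_card_sub_X_natDegree_eq L hq]
  have h0 : (X ^ q - X - C w : L[X]) ≠ 0 := by
    intro h
    rw [h, natDegree_zero] at hdeg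
    omega
  conv_rhs => rw [← hdeg]
  refine le_trans (Finset.card_le_card fun y hy => ?_) (card_le_degree_of_subset_roots
    (p := (X ^ q - X - C w : L[X])) (Z := (X ^ q - X - C w : L[X]).roots.toFinset) (by simp))
  simpa [h0, sub_eq_zero] using hy

variable {F : Type*} [Field F] [Fintype F] {L : Type*} [Field L] [Fintype L] [Algebra F L]

theorem trace_pow_card_sub_self (y : L) :
    Algebra.trace F L (y ^ Fintype.card F - y) = 0 := by
  have hfd : FiniteDimensional F L := Module.Finite.of_finite
  rw [map_sub, sub_eq_zero]
  exact Algebra.trace_eq_of_algEquiv (FiniteField.frobeniusAlgEquivOfAlgebraic F L) y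

/-- A lower bound for the number of `x` with `Tr (x + b / x) = 0`, in terms of the number of points
of the curve `y ^ q - y = x + b / x`. -/
theorem two_mul_card_isSquare_le_card_trace_eq_zero [DecidableEq F] [DecidableEq L]
    (h2 : (2 : L) ≠ 0) {b : F} (hb : b ≠ 0) :
    2 * (Finset.univ.filter fun y : L =>
      (y ^ Fintype.card F - y) ^ 2 - 4 * algebraMap F L b ≠ 0 ∧
        IsSquare ((y ^ Fintype.card F - y) ^ 2 - 4 * algebraMap F L b)).card ≤
      Fintype.card F * (Finset.univ.filter fun x : L =>
        x ≠ 0 ∧ Algebra.trace F L x + b * Algebra.trace F L x⁻¹ = 0).card := by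
  set β := algebraMap F L b with hβ
  have hβ0 : β ≠ 0 := by rwa [hβ, _root_.map_ne_zero]
  set T : Finset (L × L) := Finset.univ.filter fun z : L × L =>
    z.1 ≠ 0 ∧ z.2 ^ Fintype.card F - z.2 = z.1 + β * z.1⁻¹ ∧
      (z.2 ^ Fintype.card F - z.2) ^ 2 - 4 * β ≠ 0 ∧
        IsSquare ((z.2 ^ Fintype.card F - z.2) ^ 2 - 4 * β) with hT
  calc _ ≤ T.card := by
        refine Finset.mul_card_image_le_card_of_maps_to (f := Prod.snd) ?_ 2 ?_
        · intro z hz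
          simp only [hT, Finset.mem_filter, Finset.mem_univ, true_and] at hz ⊢
          exact hz.2.2
        · intro y hy
          simp only [Finset.mem_filter, Finset.mem_univ, true_and] at hy
          obtain ⟨h0, z, hz⟩ := hy
          set w := y ^ Fintype.card F - y with hw
          have hz0 : z ≠ 0 := by rintro rfl; exact h0 (by rw [hz, zero_mul])
          have h4 : (w + z) * (w - z) = 2 * 2 * β := by linear_combination hz
          have hprod : (w + z) * (w - z) ≠ 0 := by
            rw [h4]
            exact mul_ne_zero (mul_ne_zero h2 h2) hβ0
          have hmem (x : L) (hx : x ≠ 0) (hxx : x * (w - x) = β) :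
              (x, y) ∈ T.filter fun a => a.2 = y := by
            simp only [hT, Finset.mem_filter, Finset.mem_univ, true_and, and_true]
            refine ⟨hx, ?_, h0, z, hz⟩
            rw [← hw, ← hxx]
            field_simp
            ring
          have hsub : ({((w + z) / 2, y), ((w - z) / 2, y)} : Finset (L × L)) ⊆
              T.filter fun a => a.2 = y := by
            intro a ha
            rw [Finset.mem_insert, Finset.mem_singleton] at ha
            rcases ha with rfl | rfl
            · refine hmem _ (div_ne_zero (left_ne_zero_of_mul hprod) h2) ?_
              field_simp
              linear_combination h4
            · refine hmem _ (div_ne_zero (right_ne_zero_of_mul hprod) h2) ?_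
              field_simp
              linear_combination h4
          refine le_trans (le_of_eq ?_) (Finset.card_le_card hsub)
          rw [Finset.card_pair]
          intro h
          have h5 := congrArg Prod.fst h
          simp only at h5
          field_simp at h5
          apply hz0
          apply (mul_eq_zero.1 (show 2 * z = 0 by linear_combination h5)).resolve_left h2
    _ ≤ _ := by
        refine Finset.card_le_mul_card_image_of_maps_to (f := Prod.fst) ?_ _ ?_
        · intro z hz
          simp only [hT, Finset.mem_filter, Finset.mem_univ, true_and] at hz ⊢
          refine ⟨hz.1, ?_⟩
          have := trace_pow_card_sub_self (F := F) z.2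
          rwa [hz.2.1, map_add, hβ, ← Algebra.smul_def, map_smul, smul_eq_mul] at this
        · intro x _
          refine le_trans ?_ (card_filter_pow_sub_self_eq_le Fintype.one_lt_card (x + β * x⁻¹))
          refine Finset.card_le_card_of_injOn Prod.snd ?_ ?_
          · intro z hz
            simp only [hT, Finset.coe_filter, Finset.mem_filter, Finset.mem_univ, true_and,
              Set.mem_ofPred_eq] at hz ⊢
            rw [← hz.2]
            exact hz.1.2.1
          · intro z hz z' hz' h
            simp only [Finset.coe_filter, Set.mem_ofPred_eq] at hz hz'
            exact Prod.ext (hz.2.trans hz'.2.symm) h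

end artinSchreier

section weilBound

theorem exists_add_eq_mul_eq_pow_bounds (t : ℝ) {q : ℝ} (hq : 0 < q) :
    ∃ α β : ℂ, α + β = t ∧ α * β = q ∧
      (∀ r : ℕ, -(2 * q ^ r) ≤ (α ^ (2 * r) + β ^ (2 * r)).re) ∧
      (4 * q < t ^ 2 →
        ∃ ρ : ℝ, 1 < ρ ∧ ∀ r : ℕ, ρ ^ r * q ^ r ≤ (α ^ (2 * r) + β ^ (2 * r)).re) := by
  by_cases h : t ^ 2 ≤ 4 * q
  · obtain ⟨s, hs⟩ : ∃ s : ℝ, s ^ 2 = 4 * q - t ^ 2 :=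
      ⟨√(4 * q - t ^ 2), Real.sq_sqrt (by linarith)⟩
    have hnorm (z : ℂ) (hz : z.re ^ 2 + z.im ^ 2 = q) (r : ℕ) : -(q ^ r) ≤ (z ^ (2 * r)).re := by
      have h1 := Complex.abs_re_le_norm (z ^ (2 * r))
      rw [norm_pow, pow_mul ‖z‖, Complex.sq_norm, Complex.normSq_apply, ← sq, ← sq, hz] at h1
      exact (abs_le.1 h1).1
    refine ⟨⟨t / 2, s / 2⟩, ⟨t / 2, -(s / 2)⟩, ?_, ?_, fun r => ?_, fun h' => absurd h' h.not_gt⟩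
    · apply Complex.ext <;> simp
    · apply Complex.ext
      · simp
        linear_combination hs / 4
      · simp
        ring
    · have h1 := hnorm ⟨t / 2, s / 2⟩ (by linear_combination hs / 4) r
      have h2 := hnorm ⟨t / 2, -(s / 2)⟩ (by linear_combination hs / 4) r
      rw [Complex.add_re]
      linarith
  · rw [not_le] at h
    obtain ⟨s, hs0, hs⟩ : ∃ s : ℝ, 0 < s ∧ s ^ 2 = t ^ 2 - 4 * q :=
      ⟨√(t ^ 2 - 4 * q), Real.sqrt_pos.2 (by linarith), Real.sq_sqrt (by linarith)⟩
    set x := (t + s) / 2 with hx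
    set y := (t - s) / 2 with hy
    have hxy : x * y = q := by linear_combination -hs / 4
    have hre (r : ℕ) : ((x : ℂ) ^ (2 * r) + (y : ℂ) ^ (2 * r)).re = (x ^ 2) ^ r + (y ^ 2) ^ r := by
      rw [pow_mul, pow_mul]
      norm_cast
    refine ⟨x, y, ?_, by exact_mod_cast hxy, fun r => ?_, fun _ => ?_⟩
    · rw [hx, hy]
      push_cast
      ring
    · rw [hre]
      have : 0 ≤ q ^ r := by positivity
      have : 0 ≤ (x ^ 2) ^ r + (y ^ 2) ^ r := by positivity
      linarith
    · have ht : t ≠ 0 := by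
        rintro rfl
        linarith
      have hmax : q < x ^ 2 ∨ q < y ^ 2 := by
        by_contra! hcon
        have h3 : x ^ 2 - y ^ 2 ≠ 0 := by
          have : x ^ 2 - y ^ 2 = t * s := by rw [hx, hy]; ring
          rw [this]
          exact mul_ne_zero ht hs0.ne'
        have h4 : x ^ 2 * y ^ 2 = q ^ 2 := by rw [← hxy]; ring
        apply h3
        have h5 : x ^ 2 * y ^ 2 ≤ x ^ 2 * q := mul_le_mul_of_nonneg_left hcon.2 (sq_nonneg x)
        have h6 : x ^ 2 * y ^ 2 ≤ q * y ^ 2 := mul_le_mul_of_nonneg_right hcon.1 (sq_nonneg y)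
        have h7 : q ≤ x ^ 2 := by nlinarith
        have h8 : q ≤ y ^ 2 := by nlinarith
        linarith [hcon.1, hcon.2]
      rcases hmax with hm | hm
      · refine ⟨x ^ 2 / q, (one_lt_div hq).2 hm, fun r => ?_⟩
        rw [hre, ← mul_pow, div_mul_cancel₀ _ hq.ne']
        have : 0 ≤ (y ^ 2) ^ r := by positivity
        linarith
      · refine ⟨y ^ 2 / q, (one_lt_div hq).2 hm, fun r => ?_⟩
        rw [hre, ← mul_pow, div_mul_cancel₀ _ hq.ne']
        have : 0 ≤ (x ^ 2) ^ r := by positivity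
        linarith

variable {F : Type*} [Field F]

theorem conj_kloosterman [Finite F] (L : Type*) [Field L] [Fintype L] [Algebra F L]
    (ψ : AddChar F ℂ) (a b : F) :
    (starRingEnd ℂ) (kloosterman L ψ a b) = kloosterman L ψ a b := by
  classical
  rw [kloosterman, map_sum, ← Equiv.sum_comp (Equiv.neg L)]
  refine Finset.sum_congr rfl fun x _ => ?_
  simp only [Equiv.neg_apply, neg_eq_zero, inv_neg, map_neg]
  split_ifs
  · exact map_zero _
  · rw [← AddChar.map_neg_eq_conj]
    congr 1
    ring

theorem kloosterman_zero_zero (L : Type*) [Field L] [Fintype L] [Algebra F L]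
    (ψ : AddChar F ℂ) : kloosterman L ψ 0 0 = Fintype.card L - 1 := by
  classical
  simp only [kloosterman, zero_mul, add_zero, AddChar.map_zero_eq_one]
  rw [Finset.sum_ite, Finset.sum_const_zero, zero_add, Finset.sum_const, Finset.filter_ne',
    Finset.card_erase_of_mem (Finset.mem_univ _), nsmul_one, Finset.card_univ,
    Nat.cast_sub Fintype.card_pos, Nat.cast_one]

variable [Fintype F] {ψ : AddChar F ℂ}

theorem sum_kloosterman [DecidableEq F] (L : Type*) [Field L] [Fintype L] [DecidableEq L]
    [Algebra F L] (hψ : ψ.IsPrimitive) (b : F) :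
    ∑ c : F, kloosterman L ψ c (c * b) = Fintype.card F *
      ((Finset.univ.filter fun x : L =>
        x ≠ 0 ∧ Algebra.trace F L x + b * Algebra.trace F L x⁻¹ = 0).card : ℂ) := by
  simp only [kloosterman]
  rw [Finset.sum_comm, Finset.card_filter, Nat.cast_sum, Finset.mul_sum]
  refine Finset.sum_congr rfl fun x _ => ?_
  by_cases hx : x = 0
  · simp [hx]
  · have h1 (c : F) : c * Algebra.trace F L x + c * b * Algebra.trace F L x⁻¹ =
        c * (Algebra.trace F L x + b * Algebra.trace F L x⁻¹) := by ring
    simp only [hx, if_false, h1, AddChar.sum_mulShift _ hψ]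
    by_cases h2 : Algebra.trace F L x + b * Algebra.trace F L x⁻¹ = 0
    · rw [if_pos h2, if_pos ⟨hx, h2⟩, Nat.cast_one, mul_one]
    · rw [if_neg h2, if_neg fun h => h2 h.2, Nat.cast_zero, mul_zero]

theorem neg_le_sum_re_kloosterman [DecidableEq F] {L : Type*} [Field L] [Fintype L] [Algebra F L]
    (hψ : ψ.IsPrimitive) (hq : Odd (Fintype.card F)) {b : F} (hb : b ≠ 0) {r : ℕ} (hr : 3 ≤ r)
    (hL : Fintype.card L = (Fintype.card F ^ r) ^ 2) :
    -((10 * Fintype.card F + 2) * (Fintype.card F : ℝ) ^ r) ≤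
      ∑ c ∈ Finset.univ.erase (0 : F), (kloosterman L ψ c (c * b)).re := by
  classical
  set q := Fintype.card F with hqdef
  obtain ⟨p, hp⟩ := CharP.exists F
  obtain ⟨n, hprime, hpn⟩ := FiniteField.card F p
  have : Fact p.Prime := ⟨hprime⟩
  have : CharP L p := charP_of_injective_algebraMap (algebraMap F L).injective p
  have hq1 : 1 < q := Fintype.one_lt_card
  have hq3 : 3 ≤ q := by
    obtain ⟨j, hj⟩ := hq
    omega
  have hq0 : (q : L) = 0 := by
    rw [← map_natCast (algebraMap F L), hqdef, FiniteField.cast_card_eq_zero, map_zero]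
  have hqr : 4 * q < q ^ r := by
    calc 4 * q < q ^ 3 := by
          have : 9 ≤ q * q := Nat.mul_le_mul hq3 hq3
          nlinarith
      _ ≤ q ^ r := Nat.pow_le_pow_right (by omega) hr
  have h2 : (2 : L) ≠ 0 := by
    intro h
    have h1 : ((q : ℕ) : L) = 1 := by
      obtain ⟨j, hj⟩ := hq
      rw [hj]
      push_cast
      rw [h, zero_mul, zero_add]
    exact one_ne_zero (h1.symm.trans hq0)
  have h4 : 4 * algebraMap F L b ≠ 0 := by
    rw [show (4 : L) = 2 * 2 by norm_num]
    exact mul_ne_zero (mul_ne_zero h2 h2) ((map_ne_zero _).2 hb)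
  have hA := le_two_mul_card_isSquare_artinSchreier (p := p) (s := n * r) (R := q ^ r)
    (by rw [hqdef, hpn, pow_mul]) hq.pow hL hq1 hq0 hqr h4
  have hB := two_mul_card_isSquare_le_card_trace_eq_zero (L := L) h2 hb
  have hsum := congrArg Complex.re (sum_kloosterman L hψ b)
  rw [Complex.re_sum, ← Finset.add_sum_erase _ _ (Finset.mem_univ (0 : F)), zero_mul,
    kloosterman_zero_zero, hL, ← hqdef, ← Nat.cast_mul, Complex.natCast_re, Complex.sub_re,
    Complex.natCast_re, Complex.one_re] at hsum
  have hAB := hA.trans (Nat.add_le_add_right (Nat.add_le_add_right hB _) _)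
  have hAB' : ((q : ℝ) ^ r) ^ 2 ≤ q * ((Finset.univ.filter fun x : L =>
        x ≠ 0 ∧ Algebra.trace F L x + b * Algebra.trace F L x⁻¹ = 0).card : ℝ) +
      (6 * q + 2) * (q : ℝ) ^ r + 4 * q := by exact_mod_cast hAB
  have hR1 : (1 : ℝ) ≤ (q : ℝ) ^ r := one_le_pow₀ (by exact_mod_cast hq1.le)
  have hqR : 4 * (q : ℝ) ≤ 4 * q * (q : ℝ) ^ r := le_mul_of_one_le_right (by positivity) hR1
  push_cast at hsum
  linarith

theorem kloosterman_self (ψ : AddChar F ℂ) (a b : F) : kloosterman F ψ a b =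
    open Classical in ∑ x : F, if x = 0 then 0 else ψ (a * x + b * x⁻¹) := by
  simp [kloosterman]

theorem kloosterman_self_eq_one_mul (ψ : AddChar F ℂ) {a : F} (ha : a ≠ 0) (b : F) :
    kloosterman F ψ a b = kloosterman F ψ 1 (a * b) := by
  classical
  rw [kloosterman_self, kloosterman_self, ← Equiv.sum_comp (Equiv.mulLeft₀ a ha)
    (fun x : F => if x = 0 then (0 : ℂ) else ψ (1 * x + a * b * x⁻¹))]
  refine Finset.sum_congr rfl fun x _ => ?_
  change _ = if a * x = 0 then (0 : ℂ) else ψ (1 * (a * x) + a * b * (a * x)⁻¹)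
  rw [mul_eq_zero, or_iff_right ha]
  split_ifs
  · rfl
  · congr 1
    field_simp

/-- The Weil bound for Kloosterman sums. -/
theorem norm_kloosterman_le (hψ : ψ.IsPrimitive) (hq : Odd (Fintype.card F)) {a b : F}
    (ha : a ≠ 0) (hb : b ≠ 0) :
    ‖kloosterman F ψ a b‖ ≤ 2 * √(Fintype.card F) := by
  classical
  wlog h1 : a = 1 generalizing a b
  · rw [kloosterman_self_eq_one_mul ψ ha]
    exact this one_ne_zero (mul_ne_zero ha hb) rfl
  subst h1
  have hqpos : (0 : ℝ) < Fintype.card F := by exact_mod_cast Fintype.card_pos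
  set q := Fintype.card F with hqdef
  obtain ⟨p, hp⟩ := CharP.exists F
  obtain ⟨n, hprime, hpn⟩ := FiniteField.card F p
  have : Fact p.Prime := ⟨hprime⟩
  have hreal (c : F) : kloosterman F ψ c (c * b) = ((kloosterman F ψ c (c * b)).re : ℂ) :=
    (Complex.conj_eq_iff_re.1 (conj_kloosterman F ψ c (c * b))).symm
  choose α β hadd hmul hlow hhigh using fun c : F =>
    exists_add_eq_mul_eq_pow_bounds (-(kloosterman F ψ c (c * b)).re) hqpos
  have hK (r : ℕ) (hr : 3 ≤ r) : ∃ (L : Type) (_ : Field L) (_ : Fintype L) (_ : Algebra F L),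
      Fintype.card L = (q ^ r) ^ 2 ∧ ∀ c ≠ 0, (kloosterman L ψ c (c * b)).re =
        -(α c ^ (2 * r) + β c ^ (2 * r)).re := by
    have : NeZero (2 * r) := ⟨by omega⟩
    let : Fintype (FiniteField.Extension F p (2 * r)) := Fintype.ofFinite _
    refine ⟨FiniteField.Extension F p (2 * r), inferInstance, inferInstance, inferInstance, ?_,
      fun c hc => ?_⟩
    · rw [← Nat.card_eq_fintype_card, FiniteField.natCard_extension, Nat.card_eq_fintype_card,
        ← pow_mul, mul_comm]
    · have h2 := primePowerSum_finrank ψ c (c * b) (FiniteField.Extension F p (2 * r))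
      have h3 := primePowerSum_finrank ψ c (c * b) F
      rw [Module.finrank_self] at h3
      rw [FiniteField.finrank_extension] at h2
      have h4 := primePowerSum_eq_neg_pow_add_pow hψ hc (mul_ne_zero hc hb) (α := α c) (β := β c)
        (by rw [hadd, h3, Complex.ofReal_neg, ← hreal]) (by rw [hmul, Complex.ofReal_natCast])
        (2 * r - 1)
      rw [show 2 * r - 1 + 1 = 2 * r by omega] at h4
      rw [← h2, h4, Complex.neg_re]
  by_contra! hcon
  have hbig : 4 * (q : ℝ) < (-(kloosterman F ψ 1 (1 * b)).re) ^ 2 := by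
    rw [neg_sq, ← sq_abs, ← Real.norm_eq_abs, ← Complex.norm_real, ← hreal, one_mul]
    have := pow_lt_pow_left₀ hcon (by positivity) two_ne_zero
    rw [mul_pow, Real.sq_sqrt hqpos.le] at this
    linarith
  obtain ⟨ρ, hρ, hρr⟩ := hhigh 1 hbig
  obtain ⟨r₀, hr₀⟩ := pow_unbounded_of_one_lt (12 * (q : ℝ) + 2) hρ
  obtain ⟨L, _, _, _, hcard, hKL⟩ := hK (r₀ + 3) (by omega)
  have hlower := neg_le_sum_re_kloosterman hψ hq hb (by omega) hcard
  rw [Finset.sum_congr rfl fun c hc => hKL c (Finset.ne_of_mem_erase hc),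
    Finset.sum_neg_distrib, neg_le_neg_iff] at hlower
  set R : ℝ := (q : ℝ) ^ (r₀ + 3) with hR
  have hRpos : 0 < R := by positivity
  have hmem : (1 : F) ∈ Finset.univ.erase (0 : F) := by simp
  rw [← Finset.add_sum_erase _ _ hmem] at hlower
  have h5 : -(2 * q * R) ≤ ∑ c ∈ (Finset.univ.erase (0 : F)).erase 1,
      (α c ^ (2 * (r₀ + 3)) + β c ^ (2 * (r₀ + 3))).re := by
    refine le_trans ?_ (Finset.card_nsmul_le_sum _ _ (-(2 * R)) fun c _ => hlow c _)
    have h6 : ((((Finset.univ.erase (0 : F)).erase 1).card : ℕ) : ℝ) ≤ q := by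
      exact_mod_cast Finset.card_le_univ _
    rw [nsmul_eq_mul]
    nlinarith
  have h7 := hρr (r₀ + 3)
  have h8 : ρ ^ r₀ ≤ ρ ^ (r₀ + 3) := pow_le_pow_right₀ hρ.le (by omega)
  have h9 : (12 * (q : ℝ) + 2) * R < ρ ^ (r₀ + 3) * R :=
    mul_lt_mul_of_pos_right (hr₀.trans_le h8) hRpos
  linarith

end weilBound

/-- The quadratic character of `F` with values in `ℂ`. -/
noncomputable def complexQuadraticChar (F : Type*) [Field F] [Fintype F] [DecidableEq F] :
    MulChar F ℂ :=
  (quadraticChar F).ringHomComp (Int.castRingHom ℂ)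

section quadraticSums

variable {F : Type*} [Field F] [Fintype F] [DecidableEq F] {ψ : AddChar F ℂ}

theorem complexQuadraticChar_isQuadratic : (complexQuadraticChar F).IsQuadratic :=
  (quadraticChar_isQuadratic F).comp _

theorem complexQuadraticChar_ne_one (hF : ringChar F ≠ 2) : complexQuadraticChar F ≠ 1 := by
  rw [complexQuadraticChar, Ne, MulChar.ringHomComp_eq_one_iff (RingHom.injective_int _)]
  exact quadraticChar_ne_one hF

theorem complexQuadraticChar_sq {a : F} (ha : a ≠ 0) : complexQuadraticChar F a ^ 2 = 1 := by
  rw [complexQuadraticChar, MulChar.ringHomComp_apply, ← map_pow, quadraticChar_sq_one ha, map_one]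

theorem norm_complexQuadraticChar {a : F} (ha : a ≠ 0) : ‖complexQuadraticChar F a‖ = 1 := by
  have := congrArg norm (complexQuadraticChar_sq ha)
  rw [norm_pow, norm_one] at this
  exact (pow_eq_one_iff_of_nonneg (norm_nonneg _) two_ne_zero).1 this

theorem norm_gaussSum_complexQuadraticChar (hF : ringChar F ≠ 2) (hψ : ψ.IsPrimitive) :
    ‖gaussSum (complexQuadraticChar F) ψ‖ = √(Fintype.card F) := by
  have := congrArg norm (gaussSum_sq (complexQuadraticChar_ne_one hF)
    complexQuadraticChar_isQuadratic hψ)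
  rw [norm_pow, norm_mul, norm_complexQuadraticChar (neg_ne_zero.2 one_ne_zero), one_mul,
    Complex.norm_natCast] at this
  rw [← this, Real.sqrt_sq (norm_nonneg _)]

theorem sum_complexQuadraticChar_mul (ψ : AddChar F ℂ) {a : F} (ha : a ≠ 0) :
    ∑ u : F, complexQuadraticChar F u * ψ (a * u) =
      complexQuadraticChar F a * gaussSum (complexQuadraticChar F) ψ := by
  have := gaussSum_mulShift (complexQuadraticChar F) ψ (Units.mk0 a ha)
  rw [← this, ← mul_assoc, Units.val_mk0, ← sq, complexQuadraticChar_sq ha, one_mul]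
  rfl

theorem sum_mul_left_eq_zero (hψ : ψ.IsPrimitive) {a : F} (ha : a ≠ 0) :
    ∑ u : F, ψ (a * u) = 0 := by
  simp_rw [mul_comm a]
  rw [AddChar.sum_mulShift _ hψ, if_neg ha, Nat.cast_zero]

theorem card_filter_sq_eq (hF : ringChar F ≠ 2) (u : F) :
    ((Finset.univ.filter fun y : F => y ^ 2 = u).card : ℤ) = quadraticChar F u + 1 := by
  rw [← quadraticChar_card_sqrts hF u]
  congr 2
  ext y
  simp

theorem sum_mul_sq (hF : ringChar F ≠ 2) (hψ : ψ.IsPrimitive) {a : F} (ha : a ≠ 0) :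
    ∑ y : F, ψ (a * y ^ 2) =
      complexQuadraticChar F a * gaussSum (complexQuadraticChar F) ψ := by
  have hcard (u : F) : ((Finset.univ.filter fun y : F => y ^ 2 = u).card : ℂ) =
      complexQuadraticChar F u + 1 := by
    have h := congrArg (Int.cast : ℤ → ℂ) (card_filter_sq_eq hF u)
    rwa [Int.cast_natCast, Int.cast_add, Int.cast_one] at h
  calc ∑ y : F, ψ (a * y ^ 2)
      = ∑ u : F, ∑ y ∈ Finset.univ.filter (fun y : F => y ^ 2 = u), ψ (a * y ^ 2) :=
        (Finset.sum_fiberwise _ _ _).symm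
    _ = ∑ u : F, (complexQuadraticChar F u + 1) * ψ (a * u) := by
        refine Finset.sum_congr rfl fun u _ => ?_
        rw [← hcard, ← nsmul_eq_mul, ← Finset.sum_const]
        refine Finset.sum_congr rfl fun y hy => ?_
        rw [(Finset.mem_filter.1 hy).2]
    _ = _ := by
        simp_rw [add_mul, one_mul]
        rw [Finset.sum_add_distrib, sum_complexQuadraticChar_mul ψ ha,
          sum_mul_left_eq_zero hψ ha, add_zero]

theorem sum_mul_sq_add_mul (hF : ringChar F ≠ 2) (hψ : ψ.IsPrimitive) {a : F} (ha : a ≠ 0)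
    (b : F) :
    ∑ y : F, ψ (a * y ^ 2 + b * y) = complexQuadraticChar F a *
      gaussSum (complexQuadraticChar F) ψ * ψ (-(b ^ 2 / (4 * a))) := by
  have h2 : (2 : F) ≠ 0 := Ring.two_ne_zero hF
  have h4 : (4 : F) ≠ 0 := by
    rw [show (4 : F) = 2 * 2 by norm_num]
    exact mul_ne_zero h2 h2
  rw [← sum_mul_sq hF hψ ha, Finset.sum_mul, ← Equiv.sum_comp (Equiv.addRight (b / (2 * a)))
    fun y => ψ (a * y ^ 2) * ψ (-(b ^ 2 / (4 * a)))]
  refine Finset.sum_congr rfl fun y _ => ?_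
  rw [← AddChar.map_add_eq_mul, Equiv.coe_addRight]
  congr 1
  field_simp
  ring

/-- The bound for Salié sums. -/
theorem norm_salie_le (hF : ringChar F ≠ 2) (hψ : ψ.IsPrimitive) {a : F} (ha : a ≠ 0) (b : F) :
    ‖∑ u : F, complexQuadraticChar F u * ψ (a * u + b * u⁻¹)‖ ≤ 2 * √(Fintype.card F) := by
  have hqpos : (0 : ℝ) < Fintype.card F := by exact_mod_cast Fintype.card_pos
  have h2 : (2 : F) ≠ 0 := Ring.two_ne_zero hF
  have hG := norm_gaussSum_complexQuadraticChar hF hψ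
  set G := gaussSum (complexQuadraticChar F) ψ with hGdef
  by_cases hb : b = 0
  · simp only [hb, zero_mul, add_zero]
    rw [sum_complexQuadraticChar_mul ψ ha, norm_mul, norm_complexQuadraticChar ha, hG, one_mul]
    linarith [Real.sqrt_nonneg (Fintype.card F)]
  have hterm (u : F) : G * complexQuadraticChar F (-b) *
      (complexQuadraticChar F u * ψ (a * u + b * u⁻¹)) =
        ∑ y : F, ψ (a * u + (-(b * u) * y ^ 2 + 2 * b * y)) := by
    simp_rw [AddChar.map_add_eq_mul ψ (a * u)]
    rw [← Finset.mul_sum]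
    by_cases hu : u = 0
    · subst hu
      simp only [mul_zero, neg_zero, zero_mul, zero_add,
        sum_mul_left_eq_zero hψ (mul_ne_zero h2 hb), MulChar.map_zero]
    · have h4 : (4 : F) ≠ 0 := by
        rw [show (4 : F) = 2 * 2 by norm_num]
        exact mul_ne_zero h2 h2
      have hbu : -(b * u) ≠ 0 := neg_ne_zero.2 (mul_ne_zero hb hu)
      have e1 : -((2 * b) ^ 2 / (4 * -(b * u))) = b * u⁻¹ := by
        field_simp
        ring
      rw [sum_mul_sq_add_mul hF hψ hbu, e1, ← neg_mul, map_mul (complexQuadraticChar F)]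
      ring
  have hsum : G * complexQuadraticChar F (-b) *
      ∑ u : F, complexQuadraticChar F u * ψ (a * u + b * u⁻¹) =
        Fintype.card F * ∑ y ∈ Finset.univ.filter (fun y : F => y ^ 2 = a / b), ψ (2 * b * y) := by
    rw [Finset.mul_sum]
    simp_rw [hterm]
    rw [Finset.sum_comm, Finset.mul_sum, Finset.sum_filter]
    refine Finset.sum_congr rfl fun y _ => ?_
    have e2 (u : F) : a * u + (-(b * u) * y ^ 2 + 2 * b * y) =
        u * (a - b * y ^ 2) + 2 * b * y := by ring
    simp_rw [e2, AddChar.map_add_eq_mul ψ _ (2 * b * y)]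
    rw [← Finset.sum_mul, AddChar.sum_mulShift _ hψ]
    have e3 : a - b * y ^ 2 = 0 ↔ y ^ 2 = a / b := by
      rw [eq_div_iff hb, sub_eq_zero, eq_comm, mul_comm]
    simp only [e3]
    split_ifs
    · rfl
    · rw [Nat.cast_zero, zero_mul]
  have hcard : ((Finset.univ.filter fun y : F => y ^ 2 = a / b).card : ℝ) ≤ 2 := by
    have h1 := card_filter_sq_eq hF (a / b)
    have h3 : quadraticChar F (a / b) ≤ 1 := by
      rcases quadraticChar_dichotomy (div_ne_zero ha hb) with h | h <;> norm_num [h]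
    have h5 : ((Finset.univ.filter fun y : F => y ^ 2 = a / b).card : ℤ) ≤ 2 := by linarith
    exact_mod_cast h5
  have hnorm := congrArg norm hsum
  rw [norm_mul, norm_mul, hG, norm_complexQuadraticChar (neg_ne_zero.2 hb), mul_one, norm_mul,
    Complex.norm_natCast] at hnorm
  have h6 : ‖∑ y ∈ Finset.univ.filter (fun y : F => y ^ 2 = a / b), ψ (2 * b * y)‖ ≤ 2 := by
    refine (norm_sum_le _ _).trans (le_trans ?_ hcard)
    simp [AddChar.norm_apply]
  have hs : 0 < √(Fintype.card F : ℝ) := Real.sqrt_pos.2 hqpos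
  have hss := Real.mul_self_sqrt hqpos.le
  refine le_of_mul_le_mul_left ?_ hs
  rw [hnorm]
  calc _ ≤ (Fintype.card F : ℝ) * 2 := mul_le_mul_of_nonneg_left h6 hqpos.le
    _ = _ := by linear_combination -2 * hss

theorem norm_kloosterman_le_of_ne_zero (hq : Odd (Fintype.card F)) (hψ : ψ.IsPrimitive) {a : F}
    (ha : a ≠ 0) (b : F) : ‖kloosterman F ψ a b‖ ≤ 2 * √(Fintype.card F) := by
  by_cases hb : b = 0
  · have h1 : kloosterman F ψ a b = -1 := by
      have h2 := sum_mul_left_eq_zero hψ ha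
      rw [← Finset.add_sum_erase _ _ (Finset.mem_univ (0 : F)), mul_zero,
        AddChar.map_zero_eq_one] at h2
      rw [kloosterman_self, ← Finset.add_sum_erase _ _ (Finset.mem_univ (0 : F)), if_pos rfl, hb,
        zero_add, Finset.sum_congr rfl fun x hx => ?_]
      · exact (neg_eq_of_add_eq_zero_right h2).symm
      · rw [if_neg (Finset.ne_of_mem_erase hx), zero_mul, add_zero]
    rw [h1, norm_neg, norm_one]
    have : 1 ≤ √(Fintype.card F : ℝ) :=
      Real.one_le_sqrt.2 (by exact_mod_cast Fintype.card_pos)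
    linarith
  · exact norm_kloosterman_le hψ hq ha hb

theorem norm_sum_complexQuadraticChar_pow_le (hq : Odd (Fintype.card F)) (hψ : ψ.IsPrimitive)
    (d : ℕ) {a : F} (ha : a ≠ 0) (b : F) :
    ‖∑ u ∈ Finset.univ.erase (0 : F), complexQuadraticChar F u ^ d * ψ (a * u + b * u⁻¹)‖ ≤
      2 * √(Fintype.card F) := by
  have hF : ringChar F ≠ 2 := by
    intro h
    have := FiniteField.even_card_iff_char_two.1 h
    rw [Nat.odd_iff] at hq
    omega
  rcases d.even_or_odd' with ⟨e, rfl | rfl⟩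
  · refine le_of_eq_of_le (congrArg norm ?_) (norm_kloosterman_le_of_ne_zero hq hψ ha b)
    rw [kloosterman_self, ← Finset.add_sum_erase _ _ (Finset.mem_univ (0 : F)), if_pos rfl,
      zero_add]
    refine Finset.sum_congr rfl fun x hx => ?_
    rw [if_neg (Finset.ne_of_mem_erase hx), pow_mul,
      complexQuadraticChar_sq (Finset.ne_of_mem_erase hx), one_pow, one_mul]
  · refine le_of_eq_of_le (congrArg norm ?_) (norm_salie_le hF hψ ha b)
    rw [← Finset.add_sum_erase (a := (0 : F)) Finset.univ
      (fun u => complexQuadraticChar F u * ψ (a * u + b * u⁻¹)) (Finset.mem_univ _),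
      MulChar.map_zero, zero_mul, zero_add]
    refine Finset.sum_congr rfl fun x hx => ?_
    rw [pow_succ, pow_mul, complexQuadraticChar_sq (Finset.ne_of_mem_erase hx), one_pow, one_mul]

end quadraticSums

section levelSets

theorem AddChar.map_sum_eq_prod {A M ι : Type*} [AddCommMonoid A] [CommMonoid M] (ψ : AddChar A M)
    (s : Finset ι) (f : ι → A) : ψ (∑ i ∈ s, f i) = ∏ i ∈ s, ψ (f i) := by
  classical
  induction s using Finset.induction_on with
  | empty => simp
  | insert a s ha ih => rw [Finset.sum_insert ha, Finset.prod_insert ha, ψ.map_add_eq_mul, ih]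

variable {F : Type*} [Field F] {ψ : AddChar F ℂ} {V : Type*} [AddCommGroup V] [Module F V]
  [Fintype V]

theorem sum_linearMap_eq_zero (hψ : ψ.IsPrimitive) {ℓ : V →ₗ[F] F} (hℓ : ℓ ≠ 0) :
    ∑ x : V, ψ (ℓ x) = 0 := by
  obtain ⟨x, hx⟩ : ∃ x, ℓ x ≠ 0 := by
    by_contra! h
    exact hℓ (LinearMap.ext h)
  obtain ⟨y, hy⟩ := AddChar.ne_one_iff.1 (hψ hx)
  have h1 : ψ.compAddMonoidHom ℓ.toAddMonoidHom ≠ 1 := by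
    refine AddChar.ne_one_iff.2 ⟨y • x, ?_⟩
    have h2 : ℓ (y • x) = ℓ x * y := by rw [map_smul, smul_eq_mul, mul_comm]
    change ψ (ℓ (y • x)) ≠ 1
    rw [h2]
    exact hy
  exact AddChar.sum_eq_zero_of_ne_one h1

variable [Fintype F] [DecidableEq F]

/-- Gauss sums of nondegenerate quadratic forms. -/
theorem exists_sum_quadraticForm_add_linearMap (hF : ringChar F ≠ 2) (hψ : ψ.IsPrimitive)
    (Q : QuadraticForm F V) (hQ : (QuadraticMap.polarBilin Q).Nondegenerate) :
    ∃ c : ℂ, ‖c‖ = √(Fintype.card F) ^ Module.finrank F V ∧ ∀ ℓ : V →ₗ[F] F, ∃ M : F,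
      ∀ s ≠ 0, ∑ x : V, ψ (s * Q x + ℓ x) =
        c * (complexQuadraticChar F s ^ Module.finrank F V * ψ (-M * s⁻¹)) := by
  have hfd : FiniteDimensional F V := Module.Finite.of_finite
  have h2 : (2 : F) ≠ 0 := Ring.two_ne_zero hF
  let : Invertible (2 : F) := invertibleOfNonzero h2
  have hassoc : (QuadraticMap.associated (R := F) Q).SeparatingLeft := by
    intro x hx
    refine hQ.1 x fun y => ?_
    rw [← QuadraticMap.two_nsmul_associated F, LinearMap.smul_apply, LinearMap.smul_apply, hx,
      smul_zero]
  obtain ⟨w, ⟨e⟩⟩ := QuadraticForm.equivalent_weightedSumSquares_units_of_nondegenerate' Q hassoc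
  set G := gaussSum (complexQuadraticChar F) ψ with hG
  refine ⟨∏ i : Fin (Module.finrank F V), (complexQuadraticChar F (w i) * G), ?_, fun ℓ => ?_⟩
  · rw [norm_prod]
    have hw (i : Fin (Module.finrank F V)) :
        ‖complexQuadraticChar F (w i) * G‖ = √(Fintype.card F) := by
      rw [norm_mul, norm_complexQuadraticChar (w i).ne_zero, one_mul, hG,
        norm_gaussSum_complexQuadraticChar hF hψ]
    simp_rw [hw]
    rw [Finset.prod_const, Finset.card_univ, Fintype.card_fin]
  set m : Fin (Module.finrank F V) → F := fun i => ℓ (e.symm (Pi.single i 1))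
  refine ⟨∑ i, m i ^ 2 / (4 * w i), fun s hs => ?_⟩
  have hℓ (y : Fin (Module.finrank F V) → F) : ℓ (e.symm y) = ∑ i, m i * y i := by
    have h1 : (ℓ ∘ₗ (e.symm.toLinearEquiv : (Fin (Module.finrank F V) → F) →ₗ[F] V)) y =
        ∑ i, m i * y i := by
      rw [LinearMap.pi_apply_eq_sum_univ]
      refine Finset.sum_congr rfl fun i _ => ?_
      rw [smul_eq_mul, mul_comm]
      have h2 : (fun j => if i = j then (1 : F) else 0) = Pi.single i 1 := by
        funext j
        simp [Pi.single_apply, eq_comm]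
      rw [h2]
      rfl
    exact h1
  have hQe (y : Fin (Module.finrank F V) → F) : Q (e.symm y) = ∑ i, (w i : F) * y i ^ 2 := by
    rw [QuadraticMap.IsometryEquiv.map_app, QuadraticMap.weightedSumSquares_apply]
    refine Finset.sum_congr rfl fun i _ => ?_
    rw [Units.smul_def, smul_eq_mul, sq]
  calc ∑ x : V, ψ (s * Q x + ℓ x)
      = ∑ y : Fin (Module.finrank F V) → F, ψ (s * Q (e.symm y) + ℓ (e.symm y)) :=
        (Equiv.sum_comp e.symm.toLinearEquiv.toEquiv fun x => ψ (s * Q x + ℓ x)).symm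
    _ = ∑ y : Fin (Module.finrank F V) → F, ∏ i, ψ (s * w i * y i ^ 2 + m i * y i) := by
        refine Finset.sum_congr rfl fun y _ => ?_
        rw [hQe, hℓ, ← AddChar.map_sum_eq_prod, Finset.mul_sum, ← Finset.sum_add_distrib]
        simp_rw [mul_assoc]
    _ = ∏ i, ∑ y : F, ψ (s * w i * y ^ 2 + m i * y) :=
        (Fintype.prod_sum fun i y => ψ (s * w i * y ^ 2 + m i * y)).symm
    _ = _ := by
        have h5 (i : Fin (Module.finrank F V)) : ∑ y : F, ψ (s * w i * y ^ 2 + m i * y) =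
            complexQuadraticChar F (w i) * G *
              (complexQuadraticChar F s * ψ (-(m i ^ 2 / (4 * w i)) * s⁻¹)) := by
          have hw : (w i : F) ≠ 0 := Units.ne_zero _
          rw [sum_mul_sq_add_mul hF hψ (mul_ne_zero hs hw), map_mul (complexQuadraticChar F),
            show -(m i ^ 2 / (4 * w i)) * s⁻¹ = -(m i ^ 2 / (4 * (s * w i))) by field_simp]
          ring
        simp_rw [h5]
        rw [Finset.prod_mul_distrib]
        congr 1
        rw [Finset.prod_mul_distrib, Finset.prod_const, Finset.card_univ, Fintype.card_fin,
          ← AddChar.map_sum_eq_prod, ← Finset.sum_mul, Finset.sum_neg_distrib]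

/-- The Fourier coefficients of a level set of a nondegenerate quadratic form. -/
theorem norm_sum_level_le (hq : Odd (Fintype.card F)) (hψ : ψ.IsPrimitive) (Q : QuadraticForm F V)
    (hQ : (QuadraticMap.polarBilin Q).Nondegenerate) {t : F} (ht : t ≠ 0) {ℓ : V →ₗ[F] F}
    (hℓ : ℓ ≠ 0) :
    ‖∑ x ∈ Finset.univ.filter (fun x : V => Q x = t), ψ (ℓ x)‖ ≤
      2 * (Fintype.card F : ℝ) ^ (((Module.finrank F V : ℝ) - 1) / 2) := by
  have hF : ringChar F ≠ 2 := by
    intro h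
    have := FiniteField.even_card_iff_char_two.1 h
    rw [Nat.odd_iff] at hq
    omega
  have hqpos : (0 : ℝ) < Fintype.card F := by exact_mod_cast Fintype.card_pos
  obtain ⟨c, hc, h⟩ := exists_sum_quadraticForm_add_linearMap hF hψ Q hQ
  obtain ⟨M, hM⟩ := h ℓ
  set d := Module.finrank F V
  have hsum : (Fintype.card F : ℂ) * ∑ x ∈ Finset.univ.filter (fun x : V => Q x = t), ψ (ℓ x) =
      c * ∑ s ∈ Finset.univ.erase (0 : F),
        complexQuadraticChar F s ^ d * ψ (-t * s + -M * s⁻¹) := by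
    calc _ = ∑ x : V, ∑ s : F, ψ (s * (Q x - t)) * ψ (ℓ x) := by
          rw [Finset.mul_sum, Finset.sum_filter]
          refine Finset.sum_congr rfl fun x _ => ?_
          rw [← Finset.sum_mul, AddChar.sum_mulShift _ hψ]
          simp only [sub_eq_zero]
          split_ifs
          · rfl
          · rw [Nat.cast_zero, zero_mul]
      _ = ∑ s : F, ψ (-t * s) * ∑ x : V, ψ (s * Q x + ℓ x) := by
          rw [Finset.sum_comm]
          refine Finset.sum_congr rfl fun s _ => ?_
          rw [Finset.mul_sum]
          refine Finset.sum_congr rfl fun x _ => ?_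
          rw [← AddChar.map_add_eq_mul, ← AddChar.map_add_eq_mul]
          congr 1
          ring
      _ = _ := by
          rw [← Finset.add_sum_erase _ _ (Finset.mem_univ (0 : F))]
          simp only [zero_mul, zero_add, sum_linearMap_eq_zero hψ hℓ, mul_zero]
          rw [Finset.mul_sum]
          refine Finset.sum_congr rfl fun s hs => ?_
          rw [hM s (Finset.ne_of_mem_erase hs), AddChar.map_add_eq_mul]
          ring
  have hnorm := congrArg norm hsum
  rw [norm_mul, norm_mul, Complex.norm_natCast, hc] at hnorm
  have hle := mul_le_mul_of_nonneg_left
    (norm_sum_complexQuadraticChar_pow_le hq hψ d (neg_ne_zero.2 ht) (-M))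
    (pow_nonneg (Real.sqrt_nonneg (Fintype.card F)) d)
  rw [← hnorm] at hle
  refine le_of_mul_le_mul_left (hle.trans_eq ?_) hqpos
  have e1 : √(Fintype.card F : ℝ) ^ d * √(Fintype.card F) =
      Fintype.card F * (Fintype.card F : ℝ) ^ (((d : ℝ) - 1) / 2) := by
    rw [← pow_succ, Real.sqrt_eq_rpow, ← Real.rpow_natCast, ← Real.rpow_mul hqpos.le]
    nth_rewrite 2 [← Real.rpow_one (Fintype.card F : ℝ)]
    rw [← Real.rpow_add hqpos]
    congr 1
    push_cast
    ring
  linear_combination 2 * e1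

end levelSets

section fourier

variable {F : Type*} [Field F] {ψ : AddChar F ℂ} {d : ℕ}

theorem dotProductEquiv_ne_zero {α : Fin d → F} (hα : α ≠ 0) : dotProductEquiv F (Fin d) α ≠ 0 :=
  (dotProductEquiv F (Fin d)).map_ne_zero_iff.2 hα

variable [Fintype F]

theorem sum_addChar_dotProduct [DecidableEq F] (hψ : ψ.IsPrimitive) (v : Fin d → F) :
    ∑ α : Fin d → F, ψ (α ⬝ᵥ v) = if v = 0 then (Fintype.card F : ℂ) ^ d else 0 := by
  split_ifs with hv
  · simp [hv]
  · rw [← sum_linearMap_eq_zero hψ (dotProductEquiv_ne_zero hv)]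
    refine Finset.sum_congr rfl fun α _ => ?_
    rw [dotProduct_comm, dotProductEquiv_apply_apply]

/-- The Fourier transform of the indicator function of `E`. -/
noncomputable def indicatorTransform (ψ : AddChar F ℂ) (E : Finset (Fin d → F)) (α : Fin d → F) :
    ℂ :=
  ∑ x ∈ E, ψ (α ⬝ᵥ x)

theorem conj_indicatorTransform (E : Finset (Fin d → F)) (α : Fin d → F) :
    (starRingEnd ℂ) (indicatorTransform ψ E α) = ∑ x ∈ E, ψ (-(α ⬝ᵥ x)) := by
  rw [indicatorTransform, map_sum]
  exact Finset.sum_congr rfl fun x _ => (AddChar.map_neg_eq_conj ψ _).symm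

theorem card_pow_mul_energy {F : Type} [Field F] [Fintype F] {ψ : AddChar F ℂ}
    (hψ : ψ.IsPrimitive) (E : Finset (Fin d → F)) {k : ℕ} (hk : Even k) :
    (Fintype.card F : ℝ) ^ d * energy E k =
      ∑ α : Fin d → F, ‖indicatorTransform ψ E α‖ ^ k := by
  classical
  have hcard : energy E k = #{x ∈ Fintype.piFinset fun _ : Fin k => E |
      (∑ i : Fin k with i.val < k / 2, x i) - ∑ i : Fin k with ¬ i.val < k / 2, x i = 0} := by
    refine Nat.subtype_card _ fun x => ?_
    rw [Finset.mem_filter, Fintype.mem_piFinset, sub_eq_zero]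
  obtain ⟨m, rfl⟩ := hk
  have hlow : #{i : Fin (m + m) | (i : ℕ) < (m + m) / 2} = m := by
    rw [Fin.card_filter_val_lt]
    omega
  have hhigh : #{i : Fin (m + m) | ¬ (i : ℕ) < (m + m) / 2} = m := by
    have := Finset.card_filter_add_card_filter_not (s := (univ : Finset (Fin (m + m))))
      (fun i => (i : ℕ) < (m + m) / 2)
    rw [hlow, Finset.card_univ, Fintype.card_fin] at this
    omega
  have hpow (α : Fin d → F) : ((‖indicatorTransform ψ E α‖ ^ (m + m) : ℝ) : ℂ) =
      ∑ x ∈ Fintype.piFinset fun _ : Fin (m + m) => E,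
        ψ (α ⬝ᵥ ((∑ i : Fin (m + m) with i.val < (m + m) / 2, x i) -
          ∑ i : Fin (m + m) with ¬ i.val < (m + m) / 2, x i)) := by
    calc ((‖indicatorTransform ψ E α‖ ^ (m + m) : ℝ) : ℂ)
        = indicatorTransform ψ E α ^ m * (starRingEnd ℂ) (indicatorTransform ψ E α) ^ m := by
          rw [← mul_pow, Complex.mul_conj', ← pow_mul, ← two_mul, Complex.ofReal_pow]
      _ = ∏ i : Fin (m + m), ∑ x ∈ E,
            ψ (if (i : ℕ) < (m + m) / 2 then α ⬝ᵥ x else -(α ⬝ᵥ x)) := by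
          rw [← Finset.prod_filter_mul_prod_filter_not univ
            (fun i : Fin (m + m) => (i : ℕ) < (m + m) / 2)]
          congr 1
          · rw [Finset.prod_congr rfl (g := fun _ => indicatorTransform ψ E α), Finset.prod_const,
              hlow]
            intro i hi
            simp only [if_pos (Finset.mem_filter.1 hi).2, indicatorTransform]
          · rw [Finset.prod_congr rfl (g := fun _ => (starRingEnd ℂ) (indicatorTransform ψ E α)),
              Finset.prod_const, hhigh]
            intro i hi
            simp only [if_neg (Finset.mem_filter.1 hi).2, conj_indicatorTransform]
      _ = _ := by
          rw [Finset.prod_univ_sum]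
          refine Finset.sum_congr rfl fun x _ => ?_
          rw [← AddChar.map_sum_eq_prod, Finset.sum_ite, Finset.sum_neg_distrib, ← sub_eq_add_neg,
            dotProduct_sub, dotProduct_sum, dotProduct_sum]
  have key : ((Fintype.card F : ℝ) ^ d * energy E (m + m) : ℂ) =
      ((∑ α : Fin d → F, ‖indicatorTransform ψ E α‖ ^ (m + m) : ℝ) : ℂ) := by
    rw [Complex.ofReal_sum]
    simp_rw [hpow]
    rw [Finset.sum_comm]
    simp_rw [sum_addChar_dotProduct hψ]
    rw [← Finset.sum_filter, Finset.sum_const, nsmul_eq_mul, hcard, mul_comm]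
    simp
  exact_mod_cast key

theorem card_pow_mul_nuQ {F : Type} [Field F] [Fintype F] [DecidableEq F] {ψ : AddChar F ℂ}
    (hψ : ψ.IsPrimitive) (Q : QuadraticForm F (Fin d → F)) (E : Finset (Fin d → F)) (k : ℕ)
    (t : F) :
    (Fintype.card F : ℂ) ^ d * nuQ Q E k t =
      ∑ α : Fin d → F, indicatorTransform ψ {v | Q v = t} α *
        (starRingEnd ℂ) (indicatorTransform ψ E α) ^ k := by
  have hcard : nuQ Q E k t = #{x ∈ Fintype.piFinset fun _ : Fin k => E | Q (∑ i, x i) = t} := by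
    refine Nat.subtype_card _ fun x => ?_
    rw [Finset.mem_filter, Fintype.mem_piFinset]
  have hpow (α : Fin d → F) : (starRingEnd ℂ) (indicatorTransform ψ E α) ^ k =
      ∑ x ∈ Fintype.piFinset fun _ : Fin k => E, ψ (-(α ⬝ᵥ ∑ i, x i)) := by
    have h := Finset.prod_univ_sum (fun _ : Fin k => E) fun _ x => ψ (-(α ⬝ᵥ x))
    rw [Finset.prod_const, Finset.card_univ, Fintype.card_fin, ← conj_indicatorTransform] at h
    rw [h]
    refine Finset.sum_congr rfl fun x _ => ?_
    rw [← AddChar.map_sum_eq_prod, Finset.sum_neg_distrib, dotProduct_sum]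
  symm
  calc _ = ∑ α : Fin d → F, ∑ x ∈ Fintype.piFinset fun _ : Fin k => E,
        ∑ v : Fin d → F with Q v = t, ψ (α ⬝ᵥ (v - ∑ i, x i)) := by
        refine Finset.sum_congr rfl fun α _ => ?_
        rw [hpow, Finset.mul_sum]
        refine Finset.sum_congr rfl fun x _ => ?_
        rw [indicatorTransform, Finset.sum_mul]
        refine Finset.sum_congr rfl fun v _ => ?_
        rw [← AddChar.map_add_eq_mul, dotProduct_sub, sub_eq_add_neg]
    _ = ∑ x ∈ Fintype.piFinset fun _ : Fin k => E, ∑ v : Fin d → F with Q v = t,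
        ∑ α : Fin d → F, ψ (α ⬝ᵥ (v - ∑ i, x i)) := by
        rw [Finset.sum_comm]
        exact Finset.sum_congr rfl fun x _ => Finset.sum_comm
    _ = ∑ x ∈ Fintype.piFinset fun _ : Fin k => E,
        if Q (∑ i, x i) = t then (Fintype.card F : ℂ) ^ d else 0 := by
        refine Finset.sum_congr rfl fun x _ => ?_
        simp_rw [sum_addChar_dotProduct hψ, sub_eq_zero]
        rw [Finset.sum_ite_eq']
        simp only [Finset.mem_filter, Finset.mem_univ, true_and]
    _ = _ := by
        rw [← Finset.sum_filter, Finset.sum_const, nsmul_eq_mul, hcard, mul_comm]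

end fourier

/-- Even-`k` estimate for `ν_k(t)` in terms of the sphere size and the `k`-energy. -/
theorem stmt5 (F : Type) [Field F] [Fintype F] (hq : Odd (Fintype.card F))
    (d : ℕ) (hd : 2 ≤ d) (Q : QuadraticForm F (Fin d → F))
    (hQ : LinearMap.Nondegenerate (QuadraticMap.polarBilin Q))
    (E : Finset (Fin d → F)) (k : ℕ) (hk : 2 ≤ k) (hke : Even k) (t : F) (ht : t ≠ 0) :
    |(nuQ Q E k t : ℝ) -
        (Nat.card {x : Fin d → F | Q x = t} : ℝ) * (E.card : ℝ) ^ k / (Fintype.card F : ℝ) ^ d| ≤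
      2 * (Fintype.card F : ℝ) ^ (((d : ℝ) - 1) / 2) * (energy E k : ℝ) := by
  classical
  have hψ := AddChar.FiniteField.primitiveChar_to_Complex_isPrimitive F
  set ψ := AddChar.FiniteField.primitiveChar_to_Complex F
  set B : ℝ := 2 * (Fintype.card F : ℝ) ^ (((d : ℝ) - 1) / 2)
  set S : Finset (Fin d → F) := {v | Q v = t} with hS
  have hB0 : 0 ≤ B := by positivity
  have hqd : (0 : ℝ) < (Fintype.card F : ℝ) ^ d := by
    have : (0 : ℝ) < Fintype.card F := by exact_mod_cast Fintype.card_pos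
    positivity
  have hcardS : Nat.card {x : Fin d → F | Q x = t} = #S :=
    Nat.subtype_card _ fun x => by simp [hS]
  have hzero (A : Finset (Fin d → F)) : indicatorTransform ψ A 0 = #A := by
    simp [indicatorTransform]
  have hbound (α : Fin d → F) (hα : α ≠ 0) : ‖indicatorTransform ψ S α‖ ≤ B := by
    have h := norm_sum_level_le hq hψ Q hQ ht (dotProductEquiv_ne_zero hα)
    rw [Module.finrank_fin_fun] at h
    exact h
  have hmain : ((Fintype.card F : ℂ) ^ d * nuQ Q E k t - #S * (#E : ℂ) ^ k) =
      ∑ α ∈ univ.erase 0, indicatorTransform ψ S α *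
        (starRingEnd ℂ) (indicatorTransform ψ E α) ^ k := by
    rw [card_pow_mul_nuQ hψ, ← Finset.add_sum_erase _ _ (Finset.mem_univ (0 : Fin d → F)), hzero,
      hzero, map_natCast, add_sub_cancel_left]
  have hnorm : |(Fintype.card F : ℝ) ^ d * nuQ Q E k t - #S * (#E : ℝ) ^ k| ≤
      B * ((Fintype.card F : ℝ) ^ d * energy E k) := by
    calc |(Fintype.card F : ℝ) ^ d * nuQ Q E k t - #S * (#E : ℝ) ^ k|
        = ‖(Fintype.card F : ℂ) ^ d * nuQ Q E k t - #S * (#E : ℂ) ^ k‖ := by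
          rw [← Real.norm_eq_abs, ← Complex.norm_real]
          push_cast
          rfl
      _ ≤ ∑ α ∈ univ.erase 0, B * ‖indicatorTransform ψ E α‖ ^ k := by
          rw [hmain]
          refine norm_sum_le_of_le _ fun α hα => ?_
          rw [norm_mul, norm_pow, RCLike.norm_conj]
          gcongr
          exact hbound α (Finset.ne_of_mem_erase hα)
      _ ≤ ∑ α : Fin d → F, B * ‖indicatorTransform ψ E α‖ ^ k :=
          Finset.sum_le_sum_of_subset_of_nonneg (Finset.erase_subset _ _) fun α _ _ => by
            positivity
      _ = _ := by rw [card_pow_mul_energy hψ E hke, Finset.mul_sum]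
  have hdiv : (nuQ Q E k t : ℝ) - #S * (#E : ℝ) ^ k / (Fintype.card F : ℝ) ^ d =
      ((Fintype.card F : ℝ) ^ d * nuQ Q E k t - #S * (#E : ℝ) ^ k) / (Fintype.card F : ℝ) ^ d := by
    field_simp
  rw [hcardS, hdiv, abs_div, abs_of_pos hqd, div_le_iff₀ hqd]
  linarith
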